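/- For every integer ℓ ≥ 1, m = 2ℓ, and every p ≥ 0, the following identity of formal power series in ℚ[[t]] holds: ∑_{n≥0} i_{n,p}^{(m)} · t^n/n! = det(A), where A is the ℓ×ℓ matrix over ℚ[[t]] whose first row is A_{1,j} = I_{p+ℓ−j} − I_{p+ℓ+j} (for 1 ≤ j ≤ ℓ) and whose remaining entries are A_{i,j} = I_{i+j−1} − I_{i−j−1} (for 2 ≤ i ≤ ℓ, 1 ≤ j ≤ ℓ), and where i_{n,p}^{(m)} denotes the number of involutions in I_n^{(m)} having exactly p fixed points. -/

import Mathlib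

open scoped Classical

noncomputable section

/-- `f` has a descending subsequence of length `k`. -/
def HasDescSeq {n : ℕ} (f : Fin n → Fin n) (k : ℕ) : Prop :=
  ∃ s : Fin k → Fin n, StrictMono s ∧ StrictAnti fun a => f (s a)

/-- The number of involutions of `{1,…,n}` with no descending subsequence of
length `m+1` and exactly `p` fixed points. -/
def invCountFix (m p n : ℕ) : ℕ :=
  Nat.card {τ : Equiv.Perm (Fin n) //
    Function.Involutive ⇑τ ∧ ¬ HasDescSeq (⇑τ) (m + 1) ∧
    (Finset.univ.filter fun x : Fin n => τ x = x).card = p}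

/-- The formal power series `I_i = ∑_{n ≥ max(0,−i)} t^{2n+i}/(n!·(n+i)!)` in `ℚ[[t]]`. -/
def besselI (i : ℤ) : PowerSeries ℚ :=
  PowerSeries.mk fun N =>
    if 0 ≤ (N : ℤ) - i ∧ 0 ≤ (N : ℤ) + i ∧ 2 ∣ ((N : ℤ) - i) then
      1 / ((Nat.factorial (((N : ℤ) - i) / 2).toNat : ℚ) *
           (Nat.factorial (((N : ℤ) + i) / 2).toNat : ℚ))
    else 0


/-- `S` is a set of left endpoints of arcs `x < τ x` of `τ` that are pairwise nested and
all pass over the gap just before the position `v`. -/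
def Nested (τ : ℕ → ℕ) (v : ℕ) (S : Finset ℕ) : Prop :=
  (∀ x ∈ S, x < v ∧ v ≤ τ x) ∧ StrictAntiOn τ (S : Set ℕ)

/-- Fewer than `c` pairwise nested arcs of `τ` pass over the gap just before `v`. -/
def NestLT (τ : ℕ → ℕ) (v c : ℕ) : Prop :=
  ∀ S : Finset ℕ, Nested τ v S → S.card < c

/-- The letter of `τ` at `x`: `1` if `x` opens an arc, `-1` if it closes one, `0` if it is fixed. -/
def letter (τ : ℕ → ℕ) (x : ℕ) : SignType := SignType.sign ((τ x : ℤ) - x)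

lemma letter_eq_one {τ : ℕ → ℕ} {x : ℕ} : letter τ x = 1 ↔ x < τ x := by
  rw [letter, sign_eq_one_iff]; omega

lemma letter_eq_zero {τ : ℕ → ℕ} {x : ℕ} : letter τ x = 0 ↔ τ x = x := by
  rw [letter, sign_eq_zero_iff]; omega

lemma letter_eq_neg_one {τ : ℕ → ℕ} {x : ℕ} : letter τ x = -1 ↔ τ x < x := by
  rw [letter, sign_eq_neg_one_iff]; omega

/-- The involutions with prescribed letters and with prescribed (strict) bounds on the nestings
over each gap. -/
def boundedMatchings (N : ℕ) (s : ℕ → SignType) (c : ℕ → ℕ) : Set (ℕ → ℕ) :=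
  {τ | Function.Involutive τ ∧ (∀ x, letter τ x = s x) ∧ ∀ v ≤ N, NestLT τ v (c v)}

/-- Conjugation by the transposition of `a` and `a + 1`. -/
def conjSwap (a : ℕ) (τ : ℕ → ℕ) (x : ℕ) : ℕ :=
  Equiv.swap a (a + 1) (τ (Equiv.swap a (a + 1) x))

lemma swap_lt_swap {a x y : ℕ} (hxy : x < y) (h : ¬ (x = a ∧ y = a + 1)) :
    Equiv.swap a (a + 1) x < Equiv.swap a (a + 1) y := by
  simp only [Equiv.swap_apply_def]; split_ifs <;> omega

lemma swap_lt_iff {a x v : ℕ} (h : v ≠ a + 1) : Equiv.swap a (a + 1) x < v ↔ x < v := by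
  simp only [Equiv.swap_apply_def]; split_ifs <;> omega

lemma conjSwap_conjSwap (a : ℕ) (τ : ℕ → ℕ) : conjSwap a (conjSwap a τ) = τ := by
  funext x; simp [conjSwap]

lemma conjSwap_swap (a : ℕ) (τ : ℕ → ℕ) (x : ℕ) :
    conjSwap a τ (Equiv.swap a (a + 1) x) = Equiv.swap a (a + 1) (τ x) := by
  simp [conjSwap]

lemma involutive_conjSwap {a : ℕ} {τ : ℕ → ℕ} (h : Function.Involutive τ) :
    Function.Involutive (conjSwap a τ) := by
  intro x; simp [conjSwap, h _]

lemma letter_conjSwap {a : ℕ} {τ : ℕ → ℕ} (hτ : Function.Involutive τ) (h : τ a ≠ a + 1) (x : ℕ) :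
    letter (conjSwap a τ) (Equiv.swap a (a + 1) x) = letter τ x := by
  have h' : τ (a + 1) ≠ a := fun e => h (by rw [← hτ (a + 1), e])
  rcases lt_trichotomy x (τ x) with hx | hx | hx
  · rw [letter_eq_one.2 hx, letter_eq_one, conjSwap_swap]
    exact swap_lt_swap hx (by rintro ⟨rfl, e⟩; exact h e)
  · rw [letter_eq_zero.2 hx.symm, letter_eq_zero, conjSwap_swap, ← hx]
  · rw [letter_eq_neg_one.2 hx, letter_eq_neg_one, conjSwap_swap]
    exact swap_lt_swap hx (by rintro ⟨e, rfl⟩; exact h' e)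

lemma NestLT.mono {τ : ℕ → ℕ} {v c d : ℕ} (h : NestLT τ v c) (hcd : c ≤ d) : NestLT τ v d :=
  fun S hS => (h S hS).trans_le hcd

lemma nestLT_min {τ : ℕ → ℕ} {v c d : ℕ} :
    NestLT τ v (min c d) ↔ NestLT τ v c ∧ NestLT τ v d := by
  simp only [NestLT, lt_min_iff]
  exact ⟨fun h => ⟨fun S hS => (h S hS).1, fun S hS => (h S hS).2⟩,
    fun h S hS => ⟨h.1 S hS, h.2 S hS⟩⟩

lemma NestLT.of_conjSwap {a v c : ℕ} {τ : ℕ → ℕ} (hv : v ≠ a + 1)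
    (ho : ¬ (a < τ a ∧ a + 1 < τ (a + 1)))
    (hc : ∀ x y, x < τ x → y < τ y → τ x = a → τ y = a + 1 → False)
    (h : NestLT (conjSwap a τ) v c) : NestLT τ v c := by
  intro S ⟨h1, h2⟩
  have inj := (Equiv.swap a (a + 1)).injective
  rw [← Finset.card_image_of_injective S inj]
  refine h _ ⟨?_, ?_⟩
  · intro x hx
    obtain ⟨y, hy, rfl⟩ := Finset.mem_image.1 hx
    rw [conjSwap_swap, swap_lt_iff hv, ← not_lt, swap_lt_iff hv, not_lt]
    exact h1 y hy
  · intro x' hx' y' hy' hxy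
    obtain ⟨x, hx, rfl⟩ := Finset.mem_image.1 (Finset.mem_coe.1 hx')
    obtain ⟨y, hy, rfl⟩ := Finset.mem_image.1 (Finset.mem_coe.1 hy')
    have hx1 := h1 x hx
    have hy1 := h1 y hy
    have key : x < y := by
      by_contra hn
      rcases (not_lt.1 hn).lt_or_eq with hlt | heq
      · have := swap_lt_swap (a := a) hlt (by
          rintro ⟨rfl, rfl⟩; exact ho ⟨by omega, by omega⟩)
        omega
      · rw [heq] at hxy; exact lt_irrefl _ hxy
    rw [conjSwap_swap, conjSwap_swap]
    exact swap_lt_swap (h2 hx hy key) fun e => hc y x (by omega) (by omega) e.1 e.2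

/-- If `a` opens an arc, `a + 1` does not, and they are not matched to each other, then the
nestings over the gap between them are governed by the two neighbouring gaps. -/
lemma nestLT_middle {a c : ℕ} {τ : ℕ → ℕ} (hτ : Function.Involutive τ) (ha : a < τ a)
    (hb : τ (a + 1) ≤ a + 1) (hab : τ a ≠ a + 1) :
    NestLT τ (a + 1) c ↔ NestLT τ a c ∧ NestLT τ (a + 2) c := by
  constructor
  · intro h
    refine ⟨fun S ⟨h1, h2⟩ => h S ⟨fun x hx => ?_, h2⟩, fun S ⟨h1, h2⟩ => h S ⟨fun x hx => ?_, h2⟩⟩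
    · have := h1 x hx
      have : τ x ≠ a := fun e => by
        have := hτ x; rw [e] at this; omega
      omega
    · have := h1 x hx
      have : x ≠ a + 1 := by rintro rfl; omega
      omega
  · rintro ⟨h, h'⟩ S ⟨h1, h2⟩
    by_cases haS : a ∈ S
    · refine h' S ⟨fun x hx => ?_, h2⟩
      have hx1 := h1 x hx
      rcases (show x ≤ a by omega).lt_or_eq with hlt | rfl
      · have := h2 hx haS hlt
        omega
      · omega
    · refine h S ⟨fun x hx => ?_, h2⟩
      have hx1 := h1 x hx
      have : x ≠ a := by rintro rfl; exact haS hx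
      omega

lemma nestLT_middle_of_left {a c : ℕ} {τ : ℕ → ℕ} (ha : τ a ≤ a) (h : NestLT τ a c) :
    NestLT τ (a + 1) c := by
  refine fun S ⟨h1, h2⟩ => h S ⟨fun x hx => ?_, h2⟩
  have := h1 x hx
  have : x ≠ a := by rintro rfl; omega
  omega

/-- The bounds obtained by imposing the bound at the gap `a + 1` also on its two neighbours. -/
def spreadBound (a : ℕ) (c : ℕ → ℕ) (v : ℕ) : ℕ :=
  if v = a ∨ v = a + 2 then min (c v) (c (a + 1)) else c v

lemma conjSwap_mem_iff {N a : ℕ} {s : ℕ → SignType} {c : ℕ → ℕ} (haN : a + 2 ≤ N)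
    (ha : s a = 1) (hb : s (a + 1) ≠ 1) {τ : ℕ → ℕ} :
    conjSwap a τ ∈ boundedMatchings N (s ∘ Equiv.swap a (a + 1)) (spreadBound a c) ↔
      τ ∈ boundedMatchings N s c ∧ τ a ≠ a + 1 := by
  have main : ∀ τ : ℕ → ℕ, Function.Involutive τ → a < τ a → τ (a + 1) ≤ a + 1 → τ a ≠ a + 1 →
      ((∀ v ≤ N, NestLT (conjSwap a τ) v (spreadBound a c v)) ↔ ∀ v ≤ N, NestLT τ v (c v)) := by
    intro τ hτ h1 h2 h3
    have h4 : conjSwap a τ a ≤ a := by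
      simp only [conjSwap, Equiv.swap_apply_left]
      have : τ (a + 1) ≠ a := fun e => h3 (by rw [← hτ (a + 1), e])
      simp only [Equiv.swap_apply_def]; split_ifs <;> omega
    have h5 : a + 1 < conjSwap a τ (a + 1) := by
      simp only [conjSwap, Equiv.swap_apply_right]
      simp only [Equiv.swap_apply_def]; split_ifs <;> omega
    have key : ∀ v d, v ≠ a + 1 → (NestLT (conjSwap a τ) v d ↔ NestLT τ v d) := by
      intro v d hv
      refine ⟨NestLT.of_conjSwap hv (by omega) ?_, fun h => NestLT.of_conjSwap hv (by omega) ?_ ?_⟩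
      · intro x y hx hy e _
        have := hτ x
        rw [e] at this; omega
      · intro x y hx hy _ e
        have := involutive_conjSwap (a := a) hτ y
        rw [e] at this; omega
      · rwa [conjSwap_conjSwap]
    constructor
    · intro h v hv
      have ha' := h a (by omega)
      have hb' := h (a + 2) (by omega)
      simp only [spreadBound, true_or, or_true, if_true] at ha' hb'
      rw [key _ _ (by omega), nestLT_min] at ha' hb'
      by_cases hv1 : v = a + 1
      · subst hv1
        exact (nestLT_middle hτ h1 h2 h3).2 ⟨ha'.2, hb'.2⟩
      · have := h v hv
        rw [key _ _ hv1] at this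
        refine this.mono ?_
        unfold spreadBound; split_ifs <;> simp
    · intro h v hv
      have hm := (nestLT_middle hτ h1 h2 h3).1 (h (a + 1) (by omega))
      by_cases hv1 : v = a + 1
      · subst hv1
        refine nestLT_middle_of_left h4 ((key _ _ (by omega)).2 ?_)
        simpa [spreadBound] using hm.1
      · rw [key _ _ hv1]
        unfold spreadBound
        split_ifs with hh
        · rw [nestLT_min]
          refine ⟨h v hv, ?_⟩
          rcases hh with rfl | rfl
          exacts [hm.1, hm.2]
        · exact h v hv
  constructor
  · rintro ⟨h1, h2, h3⟩
    have hτ : Function.Involutive τ := by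
      rw [← conjSwap_conjSwap a τ]; exact involutive_conjSwap h1
    have ha' : a + 1 < conjSwap a τ (a + 1) := by
      rw [← letter_eq_one, h2]; simpa using ha
    have hab : τ a ≠ a + 1 := by
      intro e
      simp [conjSwap, e] at ha'
    have hl : ∀ x, letter τ x = s x := by
      intro x
      rw [← letter_conjSwap hτ hab, h2]; simp
    have hb' : τ (a + 1) ≤ a + 1 := by
      by_contra hn
      exact hb (by rw [← hl, letter_eq_one]; omega)
    exact ⟨⟨hτ, hl, (main τ hτ (by rw [← letter_eq_one, hl, ha]) hb' hab).1 h3⟩, hab⟩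
  · rintro ⟨⟨hτ, hl, h3⟩, hab⟩
    have hb' : τ (a + 1) ≤ a + 1 := by
      by_contra hn
      exact hb (by rw [← hl, letter_eq_one]; omega)
    refine ⟨involutive_conjSwap hτ, fun x => ?_,
      (main τ hτ (by rw [← letter_eq_one, hl, ha]) hb' hab).2 h3⟩
    have := letter_conjSwap hτ hab (Equiv.swap a (a + 1) x)
    rw [Equiv.swap_apply_self] at this
    rw [this, hl]; rfl

/-- Cut the arc joining `a` and `a + 1`. -/
def cutArc (a : ℕ) (τ : ℕ → ℕ) (x : ℕ) : ℕ :=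
  if x = a ∨ x = a + 1 then x else τ x

/-- Join `a` and `a + 1` by an arc. -/
def joinArc (a : ℕ) (τ : ℕ → ℕ) (x : ℕ) : ℕ :=
  if x = a then a + 1 else if x = a + 1 then a else τ x

lemma nestLT_joinArc_of_ne {a v c : ℕ} {τ : ℕ → ℕ} (h1 : τ a = a) (h2 : τ (a + 1) = a + 1)
    (hv : v ≠ a + 1) : NestLT (joinArc a τ) v c ↔ NestLT τ v c := by
  refine forall_congr' fun S => imp_congr_left ?_
  constructor
  · rintro ⟨h, h'⟩
    have e : ∀ x ∈ S, joinArc a τ x = τ x := by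
      intro x hx
      have := h x hx
      unfold joinArc at this ⊢
      split_ifs at this ⊢ <;> omega
    refine ⟨fun x hx => e x hx ▸ h x hx, fun x hx y hy hxy => ?_⟩
    rw [← e x hx, ← e y hy]; exact h' hx hy hxy
  · rintro ⟨h, h'⟩
    have e : ∀ x ∈ S, joinArc a τ x = τ x := by
      intro x hx
      have := h x hx
      have : x ≠ a := by rintro rfl; omega
      have : x ≠ a + 1 := by rintro rfl; omega
      simp [joinArc, *]
    refine ⟨fun x hx => (e x hx).symm ▸ h x hx, fun x hx y hy hxy => ?_⟩
    rw [e x hx, e y hy]; exact h' hx hy hxy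

lemma nestLT_joinArc_middle {a c : ℕ} {τ : ℕ → ℕ} (hτ : Function.Involutive τ) (h1 : τ a = a)
    (h2 : τ (a + 1) = a + 1) :
    NestLT (joinArc a τ) (a + 1) c ↔ NestLT τ (a + 1) (c - 1) := by
  have e : ∀ x, x < a → joinArc a τ x = τ x := by
    intro x hx
    unfold joinArc; split_ifs <;> omega
  have ea : joinArc a τ a = a + 1 := by simp [joinArc]
  constructor
  · rintro h S ⟨h3, h4⟩
    have hS : ∀ x ∈ S, x < a := by
      intro x hx
      have := h3 x hx
      have : x ≠ a := by rintro rfl; omega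
      omega
    have haS : a ∉ S := fun ha => lt_irrefl _ (hS a ha)
    have := h (insert a S) ⟨?_, ?_⟩
    · rw [Finset.card_insert_of_notMem haS] at this
      omega
    · intro x hx
      rcases Finset.mem_insert.1 hx with rfl | hx
      · rw [ea]; omega
      · rw [e x (hS x hx)]; exact h3 x hx
    · intro x hx' y hy' hxy
      rcases Finset.mem_insert.1 (Finset.mem_coe.1 hx') with rfl | hx
      · rcases Finset.mem_insert.1 (Finset.mem_coe.1 hy') with rfl | hy
        · omega
        · have := hS y hy; omega
      · rw [e x (hS x hx)]
        rcases Finset.mem_insert.1 (Finset.mem_coe.1 hy') with rfl | hy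
        · rw [ea]
          have := h3 x hx
          have : τ x ≠ y + 1 := fun e' => by
            have := hτ x
            rw [e', h2] at this; omega
          omega
        · rw [e y (hS y hy)]; exact h4 hx hy hxy
  · rintro h S ⟨h3, h4⟩
    have := h (S.erase a) ⟨?_, ?_⟩
    · have := Finset.pred_card_le_card_erase (s := S) (a := a)
      omega
    · intro x hx
      have hx' := Finset.mem_erase.1 hx
      have := h3 x hx'.2
      rw [← e x (by omega)]; exact this
    · intro x hx y hy hxy
      have hx' := Finset.mem_erase.1 (Finset.mem_coe.1 hx)
      have hy' := Finset.mem_erase.1 (Finset.mem_coe.1 hy)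
      have := h3 x hx'.2
      have := h3 y hy'.2
      rw [← e x (by omega), ← e y (by omega)]
      exact h4 hx'.2 hy'.2 hxy

lemma joinArc_mem_iff {N a : ℕ} {s : ℕ → SignType} {c : ℕ → ℕ} (haN : a + 2 ≤ N)
    (ha : s a = 1) (hb : s (a + 1) = -1) {τ : ℕ → ℕ} (h1 : τ a = a) (h2 : τ (a + 1) = a + 1) :
    joinArc a τ ∈ boundedMatchings N s c ↔
      τ ∈ boundedMatchings N (Function.update (Function.update s a 0) (a + 1) 0)
        (Function.update c (a + 1) (c (a + 1) - 1)) := by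
  have ea : joinArc a τ a = a + 1 := by simp [joinArc]
  have eb : joinArc a τ (a + 1) = a := by simp [joinArc]
  have e : ∀ x, x ≠ a → x ≠ a + 1 → joinArc a τ x = τ x := by
    intro x hx hx'
    simp [joinArc, hx, hx']
  have hinv : Function.Involutive (joinArc a τ) ↔ Function.Involutive τ := by
    constructor
    · intro h x
      by_cases hx : x = a
      · subst hx; rw [h1, h1]
      by_cases hx' : x = a + 1
      · subst hx'; rw [h2, h2]
      have := h x
      rw [e x hx hx', e] at this
      · exact this
      · intro e'; rw [e', ea] at this; exact hx' this.symm
      · intro e'; rw [e', eb] at this; exact hx this.symm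
    · intro h x
      by_cases hx : x = a
      · subst hx; rw [ea, eb]
      by_cases hx' : x = a + 1
      · subst hx'; rw [eb, ea]
      have := h x
      rw [e x hx hx', e _ _ _, h x]
      · intro e'; rw [e', h1] at this; exact hx this.symm
      · intro e'; rw [e', h2] at this; exact hx' this.symm
  rw [boundedMatchings, boundedMatchings, Set.mem_ofPred_eq, Set.mem_ofPred_eq, hinv]
  refine and_congr_right fun hτ => and_congr (forall_congr' fun x => ?_)
    (forall_congr' fun v => forall_congr' fun _ => ?_)
  · by_cases hx' : x = a + 1
    · subst hx'
      have : letter (joinArc a τ) (a + 1) = -1 := letter_eq_neg_one.2 (by rw [eb]; omega)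
      rw [this, letter_eq_zero.2 h2]
      simp [hb]
    by_cases hx : x = a
    · subst hx
      have : letter (joinArc x τ) x = 1 := letter_eq_one.2 (by rw [ea]; omega)
      rw [this, letter_eq_zero.2 h1]
      simp [ha]
    · simp [letter, e x hx hx', hx, hx']
  · by_cases hv : v = a + 1
    · subst hv
      rw [nestLT_joinArc_middle hτ h1 h2, Function.update_self]
    · rw [nestLT_joinArc_of_ne h1 h2 hv, Function.update_of_ne hv]

lemma apply_lt_of_mem_boundedMatchings {N : ℕ} {s : ℕ → SignType} {c : ℕ → ℕ}
    (hs : ∀ x, N ≤ x → s x = 0) {τ : ℕ → ℕ} (h : τ ∈ boundedMatchings N s c) {x : ℕ}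
    (hx : x < N) : τ x < N := by
  by_contra hn
  have : τ (τ x) = τ x := letter_eq_zero.1 (by rw [h.2.1, hs _ (not_lt.1 hn)])
  rw [h.1] at this
  omega

lemma finite_boundedMatchings {N : ℕ} {s : ℕ → SignType} {c : ℕ → ℕ}
    (hs : ∀ x, N ≤ x → s x = 0) : (boundedMatchings N s c).Finite := by
  have : Function.Injective fun (τ : boundedMatchings N s c) (x : Fin N) =>
      (⟨τ.1 x, apply_lt_of_mem_boundedMatchings hs τ.2 x.2⟩ : Fin N) := by
    intro τ τ' h
    ext x
    by_cases hx : x < N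
    · exact congrArg Fin.val (congrFun h ⟨x, hx⟩)
    · rw [letter_eq_zero.1 ((τ.2.2.1 x).trans (hs x (not_lt.1 hx))),
        letter_eq_zero.1 ((τ'.2.2.1 x).trans (hs x (not_lt.1 hx)))]
  exact Set.finite_coe_iff.1 (Finite.of_injective _ this)

lemma injective_conjSwap (a : ℕ) : Function.Injective (conjSwap a) :=
  Function.LeftInverse.injective (conjSwap_conjSwap a)

lemma boundedMatchings_eq_image_conjSwap {N a : ℕ} {s : ℕ → SignType} {c : ℕ → ℕ}
    (haN : a + 2 ≤ N) (ha : s a = 1) (hb : s (a + 1) ≠ 1) :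
    {τ ∈ boundedMatchings N s c | τ a ≠ a + 1} = Set.image (conjSwap a)
      (boundedMatchings N (s ∘ Equiv.swap a (a + 1)) (spreadBound a c)) := by
  ext τ
  rw [Set.mem_ofPred_eq, ← conjSwap_mem_iff haN ha hb]
  constructor
  · exact fun h => ⟨_, h, conjSwap_conjSwap a τ⟩
  · rintro ⟨τ, h, rfl⟩
    rwa [conjSwap_conjSwap]

lemma ncard_boundedMatchings_swap {N a : ℕ} {s : ℕ → SignType} {c : ℕ → ℕ}
    (haN : a + 2 ≤ N) (ha : s a = 1) (hb : s (a + 1) = 0) :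
    (boundedMatchings N s c).ncard =
      (boundedMatchings N (s ∘ Equiv.swap a (a + 1)) (spreadBound a c)).ncard := by
  rw [← Set.ncard_image_of_injective (boundedMatchings N (s ∘ Equiv.swap a (a + 1)) _)
      (injective_conjSwap a),
    ← boundedMatchings_eq_image_conjSwap haN ha (by rw [hb]; decide)]
  congr 1
  ext τ
  refine ⟨fun h => ⟨h, fun e => ?_⟩, fun h => h.1⟩
  have h' : τ (a + 1) = a + 1 := letter_eq_zero.1 ((h.2.1 _).trans hb)
  have := h.1 a
  rw [e, h'] at this
  omega

lemma ncard_boundedMatchings_cut {N a : ℕ} {s : ℕ → SignType} {c : ℕ → ℕ}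
    (hs : ∀ x, N ≤ x → s x = 0)
    (haN : a + 2 ≤ N) (ha : s a = 1) (hb : s (a + 1) = -1) :
    (boundedMatchings N s c).ncard =
      (boundedMatchings N (s ∘ Equiv.swap a (a + 1)) (spreadBound a c)).ncard +
      (boundedMatchings N (Function.update (Function.update s a 0) (a + 1) 0)
        (Function.update c (a + 1) (c (a + 1) - 1))).ncard := by
  set M := boundedMatchings N (Function.update (Function.update s a 0) (a + 1) 0)
        (Function.update c (a + 1) (c (a + 1) - 1)) with hM
  have hfix : ∀ τ ∈ M, τ a = a ∧ τ (a + 1) = a + 1 := fun τ hτ =>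
    ⟨letter_eq_zero.1 ((hτ.2.1 a).trans (by simp)),
      letter_eq_zero.1 ((hτ.2.1 (a + 1)).trans (by simp))⟩
  have hinj : Set.InjOn (joinArc a) M := by
    intro τ hτ τ' hτ' h
    funext x
    by_cases hx : x = a
    · subst hx; rw [(hfix τ hτ).1, (hfix τ' hτ').1]
    by_cases hx' : x = a + 1
    · subst hx'; rw [(hfix τ hτ).2, (hfix τ' hτ').2]
    · simpa [joinArc, hx, hx'] using congrFun h x
  rw [← Set.ncard_image_of_injective (boundedMatchings N (s ∘ Equiv.swap a (a + 1)) _)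
      (injective_conjSwap a),
    ← boundedMatchings_eq_image_conjSwap haN ha (by rw [hb]; decide),
    ← hinj.ncard_image, ← Set.ncard_union_eq ?_ ?_ ?_]
  · congr 1
    ext τ
    constructor
    · intro h
      by_cases e : τ a = a + 1
      · right
        have e' : τ (a + 1) = a := by rw [← e, h.1]
        have hj : joinArc a (cutArc a τ) = τ := by
          funext x
          unfold joinArc cutArc
          split_ifs with h1 h2 h3
          · rw [h1, e]
          · rw [h2, e']
          · omega
          · rfl
        refine ⟨cutArc a τ, ?_, hj⟩
        rw [← joinArc_mem_iff haN ha hb (by simp [cutArc]) (by simp [cutArc]), hj]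
        exact h
      · exact Or.inl ⟨h, e⟩
    · rintro (h | ⟨τ, hτ, rfl⟩)
      · exact h.1
      · exact (joinArc_mem_iff haN ha hb (hfix τ hτ).1 (hfix τ hτ).2).2 hτ
  · rw [Set.disjoint_left]
    rintro τ h ⟨τ', _, rfl⟩
    exact h.2 (by simp [joinArc])
  · exact (finite_boundedMatchings hs).subset fun τ h => h.1
  · refine (finite_boundedMatchings fun x hx => ?_).image _
    rw [Function.update_of_ne (by omega), Function.update_of_ne (by omega), hs x hx]

/-- Integer partitions, seen as antitone sequences, with fewer than `c` parts. -/
def Chamber (c : ℕ) (x : ℕ → ℤ) : Prop :=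
  Antitone x ∧ 0 < c ∧ ∀ i, c ≤ i + 1 → x i = 0

/-- Sum of `f` over all ways to decrease one of the first `ℓ` coordinates. -/
def sumDecr {M : Type*} [AddCommMonoid M] (ℓ : ℕ) (f : (ℕ → ℤ) → M) (x : ℕ → ℤ) : M :=
  ∑ i ∈ Finset.range ℓ, f (x - Pi.single i 1)

/-- Sum of `f` over all ways to increase one of the first `ℓ` coordinates. -/
def sumIncr {M : Type*} [AddCommMonoid M] (ℓ : ℕ) (f : (ℕ → ℤ) → M) (x : ℕ → ℤ) : M :=
  ∑ i ∈ Finset.range ℓ, f (x + Pi.single i 1)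

/-- Restriction of `f` to the partitions with fewer than `c` parts. -/
def chamberRestrict {M : Type*} [AddCommMonoid M] (c : ℕ) (f : (ℕ → ℤ) → M) (x : ℕ → ℤ) : M :=
  if Chamber c x then f x else 0

/-- The effect of one step: add a box, remove a box, or stay. -/
def walkStep (ℓ : ℕ) (ε : SignType) (f : (ℕ → ℤ) → ℕ) : (ℕ → ℤ) → ℕ :=
  if ε = 1 then sumDecr ℓ f else if ε = -1 then sumIncr ℓ f else f

/-- The number of walks of partitions from the empty partition, with steps prescribed by `s` and
numbers of parts (strictly) bounded by `c`. -/
def walkCount (ℓ : ℕ) (s : ℕ → SignType) (c : ℕ → ℕ) : ℕ → (ℕ → ℤ) → ℕ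
  | 0 => chamberRestrict (c 0) fun x => if x = 0 then 1 else 0
  | k + 1 => chamberRestrict (c (k + 1)) (walkStep ℓ (s k) (walkCount ℓ s c k))

lemma Chamber.nonneg {c : ℕ} {x : ℕ → ℤ} (h : Chamber c x) (i : ℕ) : 0 ≤ x i := by
  rw [← h.2.2 (i + c) (by omega)]
  exact h.1 (by omega)

lemma chamber_min {c d : ℕ} {x : ℕ → ℤ} : Chamber (min c d) x ↔ Chamber c x ∧ Chamber d x := by
  simp only [Chamber, lt_min_iff, min_le_iff]
  constructor
  · rintro ⟨h1, h2, h3⟩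
    exact ⟨⟨h1, h2.1, fun i hi => h3 i (Or.inl hi)⟩, ⟨h1, h2.2, fun i hi => h3 i (Or.inr hi)⟩⟩
  · rintro ⟨⟨h1, h2, h3⟩, ⟨_, h5, h6⟩⟩
    exact ⟨h1, ⟨h2, h5⟩, fun i hi => hi.elim (h3 i) (h6 i)⟩

lemma Chamber.mono {c d : ℕ} {x : ℕ → ℤ} (h : Chamber c x) (hcd : c ≤ d) : Chamber d x :=
  ⟨h.1, h.2.1.trans_le hcd, fun i hi => h.2.2 i (hcd.trans hi)⟩

lemma chamber_zero {c : ℕ} : Chamber c 0 ↔ 0 < c :=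
  ⟨fun h => h.2.1, fun h => ⟨antitone_const, h, fun _ _ => rfl⟩⟩

/-- If `x ≤ y` in the coordinatewise order and `y` has fewer than `c` parts, so does `x`. -/
lemma Chamber.of_le {c : ℕ} {x y : ℕ → ℤ} (hy : Chamber c y) (hx : Antitone x)
    (h0 : ∀ i, 0 ≤ x i) (h : ∀ i, x i ≤ y i) : Chamber c x :=
  ⟨hx, hy.2.1, fun i hi => le_antisymm ((h i).trans_eq (hy.2.2 i hi)) (h0 i)⟩

lemma chamberRestrict_chamberRestrict {M : Type*} [AddCommMonoid M] (c d : ℕ)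
    (f : (ℕ → ℤ) → M) :
    chamberRestrict c (chamberRestrict d f) = chamberRestrict (min c d) f := by
  funext x
  simp only [chamberRestrict, chamber_min]
  split_ifs <;> tauto

lemma antitone_nat_iff {x : ℕ → ℤ} : Antitone x ↔ ∀ i, x (i + 1) ≤ x i :=
  ⟨fun h i => h (Nat.le_succ i), antitone_nat_of_succ_le⟩

lemma add_single_apply (x : ℕ → ℤ) (i k : ℕ) :
    (x + Pi.single i 1 : ℕ → ℤ) k = x k + if k = i then 1 else 0 := by
  simp [Pi.single_apply]

lemma sub_single_apply (x : ℕ → ℤ) (i k : ℕ) :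
    (x - Pi.single i 1 : ℕ → ℤ) k = x k - if k = i then 1 else 0 := by
  simp [Pi.single_apply]

lemma chamber_add_single_iff {c i : ℕ} {x : ℕ → ℤ} (h : Chamber c x) :
    Chamber c (x + Pi.single i 1) ↔ i + 1 < c ∧ (i = 0 ∨ x i < x (i - 1)) := by
  constructor
  · rintro ⟨h1, h2, h3⟩
    refine ⟨?_, ?_⟩
    · by_contra hn
      have := h3 i (by omega)
      rw [add_single_apply, h.2.2 i (by omega)] at this
      simp at this
    · rcases Nat.eq_zero_or_pos i with h0 | h0
      · exact Or.inl h0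
      · right
        have := h1 (Nat.sub_le i 1)
        rw [add_single_apply, add_single_apply, if_pos rfl, if_neg (by omega)] at this
        omega
  · rintro ⟨h1, h2⟩
    refine ⟨antitone_nat_iff.2 fun k => ?_, h.2.1, fun k hk => ?_⟩
    · rw [add_single_apply, add_single_apply]
      have := antitone_nat_iff.1 h.1 k
      split_ifs with h3 h4 h4
      · omega
      · subst h3
        simp at h2
        omega
      · omega
      · omega
    · rw [add_single_apply, h.2.2 k hk, if_neg (by omega)]; rfl

lemma chamber_sub_single_iff {c i : ℕ} {x : ℕ → ℤ} (h : Chamber c x) :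
    Chamber c (x - Pi.single i 1) ↔ x (i + 1) < x i := by
  constructor
  · rintro ⟨h1, h2, h3⟩
    have := antitone_nat_iff.1 h1 i
    rw [sub_single_apply, sub_single_apply, if_pos rfl, if_neg (by omega)] at this
    omega
  · intro h1
    refine ⟨antitone_nat_iff.2 fun k => ?_, h.2.1, fun k hk => ?_⟩
    · rw [sub_single_apply, sub_single_apply]
      have := antitone_nat_iff.1 h.1 k
      split_ifs with h3 h4 h4
      · omega
      · omega
      · subst h4; omega
      · omega
    · rw [sub_single_apply, h.2.2 k hk, if_neg]; rfl
      rintro rfl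
      rw [h.2.2 k hk, h.2.2 (k + 1) (by omega)] at h1
      exact lt_irrefl _ h1

/-- A partition has one more addable box than removable boxes, up to the bound on its parts. -/
lemma card_addable {ℓ c : ℕ} (hc : c ≤ ℓ + 1) {x : ℕ → ℤ} (h : Chamber c x) :
    (∑ i ∈ Finset.range ℓ, if Chamber c (x + Pi.single i 1) then 1 else 0) =
      (∑ i ∈ Finset.range ℓ, if Chamber c (x - Pi.single i 1) then 1 else 0) +
        if Chamber (c - 1) x then 1 else 0 := by
  simp only [chamber_add_single_iff h, chamber_sub_single_iff h]
  have hx := h.2.2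
  rcases c with - | - | m
  · exact absurd h.2.1 (lt_irrefl _)
  · rw [if_neg (fun h' => absurd h'.2.1 (Nat.not_lt_zero _)), add_zero]
    refine Finset.sum_congr rfl fun i _ => ?_
    rw [if_neg (by omega), if_neg (by rw [hx i (by omega), hx (i + 1) (by omega)]; omega)]
  · have hm : Chamber (m + 1 + 1 - 1) x ↔ x m = 0 := by
      refine ⟨fun h' => h'.2.2 m (by omega), fun h' => ⟨h.1, by omega, fun i hi => ?_⟩⟩
      rcases hi.lt_or_eq with hlt | heq
      · exact hx i (by omega)
      · rw [← h']; congr 1; omega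
    have hsub : Finset.range (m + 1) ⊆ Finset.range ℓ := Finset.range_subset_range.2 (by omega)
    rw [← Finset.sum_subset hsub, ← Finset.sum_subset hsub, Finset.sum_range_succ',
      Finset.sum_range_succ]
    · refine Eq.trans ?_ (add_assoc _ _ _).symm
      refine congrArg₂ (· + ·) (Finset.sum_congr rfl fun i hi => ?_) ?_
      · have := Finset.mem_range.1 hi
        simp [this]
      · rw [hx (m + 1) (by omega)]
        have := h.nonneg m
        simp only [hm]
        rcases this.lt_or_eq with h0 | h0
        · simp [h0, h0.ne']
        · simp [← h0]
    · intro i _ hi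
      rw [Finset.mem_range] at hi
      rw [hx i (by omega), hx (i + 1) (by omega)]; simp
    · intro i _ hi
      rw [Finset.mem_range] at hi
      rw [if_neg]; omega

lemma chamber_square {c d i j : ℕ} {x : ℕ → ℤ} (hij : i ≠ j) (hx : Chamber c x)
    (hy : Chamber d (x + Pi.single i 1 - Pi.single j 1)) :
    Chamber c (x + Pi.single i 1) ↔
      Chamber c (x - Pi.single j 1) ∧ Chamber c (x + Pi.single i 1 - Pi.single j 1) := by
  have hxa := antitone_nat_iff.1 hx.1
  have hya := antitone_nat_iff.1 hy.1
  have hy0 := hy.nonneg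
  simp only [sub_single_apply, add_single_apply] at hya hy0
  constructor
  · intro h
    have h2 : Chamber c (x + Pi.single i 1 - Pi.single j 1) := by
      refine h.of_le hy.1 hy.nonneg fun k => ?_
      rw [sub_single_apply]; split_ifs <;> omega
    refine ⟨hx.of_le (antitone_nat_iff.2 fun k => ?_) (fun k => ?_) fun k => ?_, h2⟩
    · have h3 := hxa k
      have h4 := hya k
      simp only [sub_single_apply]
      split_ifs at h4 ⊢ <;> omega
    · have h3 := hx.nonneg k
      have h4 := hy0 k
      simp only [sub_single_apply]
      split_ifs at h4 ⊢ <;> omega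
    · rw [sub_single_apply]; split_ifs <;> omega
  · rintro ⟨h1, h2⟩
    refine ⟨antitone_nat_iff.2 fun k => ?_, hx.2.1, fun k hk => ?_⟩
    · have h3 := hxa k
      have h4 := hya k
      simp only [add_single_apply]
      split_ifs at h4 ⊢ <;> omega
    · have h3 := hx.2.2 k hk
      have h4 := h2.2.2 k hk
      simp only [sub_single_apply, add_single_apply] at h4 ⊢
      split_ifs at h4 ⊢ <;> omega

/-- The commutation relation between adding and removing boxes in the presence of a bound on the
number of parts. -/
lemma sumIncr_sumDecr {ℓ c : ℕ} (hc : c ≤ ℓ + 1) {f : (ℕ → ℤ) → ℕ} {d₀ : ℕ}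
    (hf : ∀ x, f x ≠ 0 → Chamber d₀ x) {x : ℕ → ℤ} (hx : Chamber c x) :
    sumIncr ℓ (chamberRestrict c (sumDecr ℓ f)) x =
      sumDecr ℓ (chamberRestrict c (sumIncr ℓ (chamberRestrict c f))) x +
        chamberRestrict (c - 1) f x := by
  set a : ℕ → ℕ → ℕ := fun i j =>
    if Chamber c (x + Pi.single i 1) then f (x + Pi.single i 1 - Pi.single j 1) else 0 with ha
  set b : ℕ → ℕ → ℕ := fun i j => if Chamber c (x - Pi.single j 1) then
    (if Chamber c (x + Pi.single i 1 - Pi.single j 1) then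
      f (x + Pi.single i 1 - Pi.single j 1) else 0) else 0 with hb
  have hL : sumIncr ℓ (chamberRestrict c (sumDecr ℓ f)) x =
      ∑ i ∈ Finset.range ℓ, ∑ j ∈ Finset.range ℓ, a i j := by
    refine Finset.sum_congr rfl fun i _ => ?_
    simp only [chamberRestrict, sumDecr, ha]
    split_ifs <;> simp
  have hR : sumDecr ℓ (chamberRestrict c (sumIncr ℓ (chamberRestrict c f))) x =
      ∑ i ∈ Finset.range ℓ, ∑ j ∈ Finset.range ℓ, b i j := by
    rw [Finset.sum_comm]
    refine Finset.sum_congr rfl fun j _ => ?_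
    simp only [chamberRestrict, sumIncr, hb, sub_add_eq_add_sub]
    split_ifs <;> simp
  have hab : ∀ i j, i ≠ j → a i j = b i j := by
    intro i j hij
    by_cases h0 : f (x + Pi.single i 1 - Pi.single j 1) = 0
    · simp [ha, hb, h0]
    · have := chamber_square hij hx (hf _ h0)
      simp only [ha, hb, this]
      split_ifs <;> tauto
  have hda : ∀ i, a i i = (if Chamber c (x + Pi.single i 1) then 1 else 0) * f x := by
    intro i; simp [ha]
  have hdb : ∀ i, b i i = (if Chamber c (x - Pi.single i 1) then 1 else 0) * f x := by
    intro i; simp [hb, hx]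
  have hdiag : ∑ i ∈ Finset.range ℓ, a i i =
      ∑ i ∈ Finset.range ℓ, b i i + chamberRestrict (c - 1) f x := by
    simp only [hda, hdb, ← Finset.sum_mul, card_addable hc hx, add_mul, chamberRestrict]
    simp
  have hsplit : ∀ i ∈ Finset.range ℓ, ∑ j ∈ Finset.range ℓ, a i j + b i i =
      ∑ j ∈ Finset.range ℓ, b i j + a i i := by
    intro i hi
    rw [← Finset.add_sum_erase _ _ hi, ← Finset.add_sum_erase _ (b i) hi,
      Finset.sum_congr rfl fun j hj => hab i j (Finset.ne_of_mem_erase hj).symm]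
    ring
  have := Finset.sum_congr rfl hsplit
  rw [Finset.sum_add_distrib, Finset.sum_add_distrib] at this
  rw [hL, hR]
  omega

lemma sumIncr_chamberRestrict_of_not {M : Type*} [AddCommMonoid M] {ℓ c d : ℕ}
    {g : (ℕ → ℤ) → M} {x : ℕ → ℤ} (hx : Chamber d x)
    (hxc : ¬ Chamber c x) : sumIncr ℓ (chamberRestrict c g) x = 0 := by
  refine Finset.sum_eq_zero fun i _ => if_neg fun h => hxc ?_
  refine h.of_le hx.1 hx.nonneg fun k => ?_
  rw [add_single_apply]; split_ifs <;> omega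

lemma chamber_of_walkCount_ne_zero {ℓ : ℕ} {s : ℕ → SignType} {c : ℕ → ℕ} {k : ℕ} {x : ℕ → ℤ}
    (h : walkCount ℓ s c k x ≠ 0) : Chamber (c k) x := by
  by_contra hn
  cases k <;> exact h (if_neg hn)

lemma walkCount_congr {ℓ : ℕ} {s s' : ℕ → SignType} {c c' : ℕ → ℕ} {k : ℕ}
    (hs : ∀ i < k, s i = s' i) (hc : ∀ i ≤ k, c i = c' i) :
    walkCount ℓ s c k = walkCount ℓ s' c' k := by
  induction k with
  | zero => simp only [walkCount, hc 0 le_rfl]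
  | succ k ih =>
    simp only [walkCount, hc (k + 1) le_rfl, hs k (Nat.lt_succ_self k)]
    rw [ih (fun i hi => hs i (by omega)) fun i hi => hc i (by omega)]

lemma walkCount_congr_from {ℓ : ℕ} {s s' : ℕ → SignType} {c c' : ℕ → ℕ} {k n : ℕ} (hk : k ≤ n)
    (h : walkCount ℓ s c k = walkCount ℓ s' c' k)
    (hs : ∀ i, k ≤ i → s i = s' i) (hc : ∀ i, k < i → c i = c' i) :
    walkCount ℓ s c n = walkCount ℓ s' c' n := by
  induction n, hk using Nat.le_induction with
  | base => exact h
  | succ n hn ih => simp only [walkCount, hc (n + 1) (by omega), hs n hn, ih]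

lemma walkStep_add (ℓ : ℕ) (ε : SignType) (f g : (ℕ → ℤ) → ℕ) :
    walkStep ℓ ε (f + g) = walkStep ℓ ε f + walkStep ℓ ε g := by
  unfold walkStep
  split_ifs
  · funext x; simp [sumDecr, Finset.sum_add_distrib]
  · funext x; simp [sumIncr, Finset.sum_add_distrib]
  · rfl

lemma chamberRestrict_add {M : Type*} [AddCommMonoid M] (c : ℕ) (f g : (ℕ → ℤ) → M) :
    chamberRestrict c (f + g) = chamberRestrict c f + chamberRestrict c g := by
  funext x
  simp only [chamberRestrict, Pi.add_apply]
  split_ifs <;> simp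

lemma walkCount_add_from {ℓ : ℕ} {s s₁ s₂ : ℕ → SignType} {c c₁ c₂ : ℕ → ℕ} {k n : ℕ}
    (hk : k ≤ n) (h : walkCount ℓ s c k = walkCount ℓ s₁ c₁ k + walkCount ℓ s₂ c₂ k)
    (hs₁ : ∀ i, k ≤ i → s i = s₁ i) (hc₁ : ∀ i, k < i → c i = c₁ i)
    (hs₂ : ∀ i, k ≤ i → s i = s₂ i) (hc₂ : ∀ i, k < i → c i = c₂ i) :
    walkCount ℓ s c n = walkCount ℓ s₁ c₁ n + walkCount ℓ s₂ c₂ n := by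
  induction n, hk using Nat.le_induction with
  | base => exact h
  | succ n hn ih =>
    simp only [walkCount, ← hc₁ (n + 1) (by omega), ← hs₁ n hn, ← hc₂ (n + 1) (by omega),
      ← hs₂ n hn, ih, walkStep_add, chamberRestrict_add]

/-- Lowering the last bound only restricts the walk count. -/
lemma walkCount_of_min {ℓ : ℕ} {s s' : ℕ → SignType} {c c' : ℕ → ℕ} {k d : ℕ}
    (hs : ∀ i < k, s' i = s i) (hc : ∀ i < k, c' i = c i) (hk : c' k = min (c k) d) :
    walkCount ℓ s' c' k = chamberRestrict d (walkCount ℓ s c k) := by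
  cases k with
  | zero => simp only [walkCount, hk, chamberRestrict_chamberRestrict, min_comm]
  | succ k =>
    simp only [walkCount, hk, chamberRestrict_chamberRestrict, min_comm, hs k (Nat.lt_succ_self k)]
    rw [walkCount_congr (fun i hi => hs i (by omega)) fun i hi => hc i (by omega)]

lemma spreadBound_of_ne {a v : ℕ} {c : ℕ → ℕ} (h : v ≠ a) (h' : v ≠ a + 2) :
    spreadBound a c v = c v := by
  simp [spreadBound, h, h']

lemma swap_apply_of_far {a i : ℕ} (h : i < a ∨ a + 2 ≤ i) : Equiv.swap a (a + 1) i = i :=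
  Equiv.swap_apply_of_ne_of_ne (by omega) (by omega)

lemma walkCount_swap {ℓ N a : ℕ} {s : ℕ → SignType} {c : ℕ → ℕ} (haN : a + 2 ≤ N)
    (ha : s a = 1) (hb : s (a + 1) = 0) :
    walkCount ℓ s c N = walkCount ℓ (s ∘ Equiv.swap a (a + 1)) (spreadBound a c) N := by
  refine walkCount_congr_from haN ?_ (fun i hi => ?_) fun i hi => ?_
  · have h0 : walkCount ℓ (s ∘ Equiv.swap a (a + 1)) (spreadBound a c) a =
        chamberRestrict (c (a + 1)) (walkCount ℓ s c a) :=
      walkCount_of_min (fun i hi => by simp [swap_apply_of_far (Or.inl hi)])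
        (fun i hi => spreadBound_of_ne (by omega) (by omega)) (by simp [spreadBound])
    have hc1 : spreadBound a c (a + 1) = c (a + 1) := spreadBound_of_ne (by omega) (by omega)
    have hc2 : spreadBound a c (a + 1 + 1) = min (c (a + 2)) (c (a + 1)) := by simp [spreadBound]
    simp only [walkCount, h0, hc1, hc2, Function.comp_apply, Equiv.swap_apply_left,
      Equiv.swap_apply_right, ha, hb]
    have e1 : ∀ f, walkStep ℓ 1 f = sumDecr ℓ f := fun f => by simp [walkStep]
    have e0 : ∀ f, walkStep ℓ 0 f = f := fun f => by simp [walkStep]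
    simp only [e0, e1, chamberRestrict_chamberRestrict, min_self]
    funext x
    simp only [chamberRestrict, sumDecr]
    split_ifs with hx
    · refine Finset.sum_congr rfl fun i _ => ?_
      split_ifs with hi
      · rfl
      · by_contra hne
        have hw := chamber_of_walkCount_ne_zero hne
        refine hi ((chamber_min.1 hx).2.of_le hw.1 hw.nonneg fun k => ?_)
        rw [sub_single_apply]; split_ifs <;> omega
    · rfl
  · simp [swap_apply_of_far (Or.inr hi)]
  · rw [spreadBound_of_ne (by omega) (by omega)]

lemma walkCount_cut {ℓ N a : ℕ} {s : ℕ → SignType} {c : ℕ → ℕ} (haN : a + 2 ≤ N)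
    (hc : c (a + 1) ≤ ℓ + 1) (ha : s a = 1) (hb : s (a + 1) = -1) :
    walkCount ℓ s c N = walkCount ℓ (s ∘ Equiv.swap a (a + 1)) (spreadBound a c) N +
      walkCount ℓ (Function.update (Function.update s a 0) (a + 1) 0)
        (Function.update c (a + 1) (c (a + 1) - 1)) N := by
  refine walkCount_add_from haN ?_ (fun i hi => ?_) (fun i hi => ?_) (fun i hi => ?_)
    fun i hi => ?_
  · have h0 : walkCount ℓ (s ∘ Equiv.swap a (a + 1)) (spreadBound a c) a =
        chamberRestrict (c (a + 1)) (walkCount ℓ s c a) :=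
      walkCount_of_min (fun i hi => by simp [swap_apply_of_far (Or.inl hi)])
        (fun i hi => spreadBound_of_ne (by omega) (by omega)) (by simp [spreadBound])
    have h0' : walkCount ℓ (Function.update (Function.update s a 0) (a + 1) 0)
        (Function.update c (a + 1) (c (a + 1) - 1)) a = walkCount ℓ s c a :=
      walkCount_congr
        (fun i hi => by rw [Function.update_of_ne (by omega), Function.update_of_ne (by omega)])
        (fun i hi => by rw [Function.update_of_ne (by omega)])
    have hc1 : spreadBound a c (a + 1) = c (a + 1) := spreadBound_of_ne (by omega) (by omega)
    have hc2 : spreadBound a c (a + 1 + 1) = min (c (a + 2)) (c (a + 1)) := by simp [spreadBound]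
    have e1 : ∀ f, walkStep ℓ 1 f = sumDecr ℓ f := fun f => by simp [walkStep]
    have e0 : ∀ f, walkStep ℓ 0 f = f := fun f => by simp [walkStep]
    have em : ∀ f, walkStep ℓ (-1) f = sumIncr ℓ f := fun f => by
      rw [walkStep, if_neg (by decide), if_pos rfl]
    have es : Function.update (Function.update s a 0) (a + 1) 0 a = 0 := by simp
    have ec : Function.update c (a + 1) (c (a + 1) - 1) (a + 1 + 1) = c (a + 2) := by simp
    simp only [walkCount, h0, h0', hc1, hc2, Function.comp_apply, Equiv.swap_apply_left,
      Equiv.swap_apply_right, ha, hb, e1, em, es, ec, e0, Function.update_self]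
    funext x
    simp only [Pi.add_apply]
    rw [chamberRestrict, chamberRestrict, chamberRestrict]
    by_cases hx2 : Chamber (c (a + 2)) x
    · rw [if_pos hx2, if_pos hx2]
      by_cases hx1 : Chamber (c (a + 1)) x
      · rw [if_pos (chamber_min.2 ⟨hx2, hx1⟩)]
        exact sumIncr_sumDecr hc (fun y hy => chamber_of_walkCount_ne_zero hy) hx1
      · rw [if_neg fun h => hx1 (chamber_min.1 h).2, sumIncr_chamberRestrict_of_not hx2 hx1,
          chamberRestrict, if_neg fun h => hx1 (h.mono (Nat.sub_le _ _)), add_zero]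
    · rw [if_neg hx2, if_neg hx2, if_neg fun h => hx2 (chamber_min.1 h).1, add_zero]
  · simp [swap_apply_of_far (Or.inr hi)]
  · rw [spreadBound_of_ne (by omega) (by omega)]
  · rw [Function.update_of_ne (by omega), Function.update_of_ne (by omega)]
  · rw [Function.update_of_ne (by omega)]

/-- The walk count when no step adds a box. -/
lemma walkCount_of_ne_one {ℓ : ℕ} {s : ℕ → SignType} {c : ℕ → ℕ} {k : ℕ}
    (hs : ∀ i < k, s i ≠ 1) (x : ℕ → ℤ) :
    walkCount ℓ s c k x =
      if x = 0 ∧ (∀ i < k, s i = 0) ∧ ∀ v ≤ k, 0 < c v then 1 else 0 := by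
  induction k generalizing x with
  | zero =>
    by_cases hx : x = 0
    · subst hx; simp [walkCount, chamberRestrict, chamber_zero]
    · simp [walkCount, chamberRestrict, hx]
  | succ k ih =>
    have ih := ih fun i hi => hs i (by omega)
    by_cases h0 : s k = 0
    · have : walkCount ℓ s c (k + 1) x = if Chamber (c (k + 1)) x then
          if x = 0 ∧ (∀ i < k, s i = 0) ∧ ∀ v ≤ k, 0 < c v then 1 else 0 else 0 := by
        simp [walkCount, chamberRestrict, walkStep, h0, ih]
      rw [this]
      by_cases hx : x = 0
      · subst hx
        rw [chamber_zero]
        simp only [Nat.lt_succ_iff_lt_or_eq, Nat.le_succ_iff]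
        split_ifs <;> grind
      · simp [hx]
    · rw [if_neg fun h => h0 (h.2.1 k (Nat.lt_succ_self k))]
      by_contra hne
      have hx := chamber_of_walkCount_ne_zero hne
      have hm : s k = -1 := by
        have := hs k (Nat.lt_succ_self k)
        revert this h0; generalize s k = e; revert e; decide
      apply hne
      rw [walkCount, chamberRestrict, if_pos hx, hm, walkStep, if_neg (by decide), if_pos rfl]
      refine Finset.sum_eq_zero fun i _ => ?_
      rw [ih, if_neg]
      rintro ⟨h, _⟩
      have h1 := congrFun h i
      have h2 := hx.nonneg i
      rw [add_single_apply, if_pos rfl] at h1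
      simp only [Pi.zero_apply] at h1
      omega

lemma ncard_boundedMatchings_of_ne_one {N : ℕ} {s : ℕ → SignType} {c : ℕ → ℕ}
    (hs : ∀ x, N ≤ x → s x = 0) (hs1 : ∀ i < N, s i ≠ 1) :
    (boundedMatchings N s c).ncard =
      if (∀ i < N, s i = 0) ∧ ∀ v ≤ N, 0 < c v then 1 else 0 := by
  have hs1' : ∀ i, s i ≠ 1 := fun i => by
    by_cases hi : i < N
    · exact hs1 i hi
    · rw [hs i (by omega)]; decide
  have hid : ∀ τ ∈ boundedMatchings N s c, τ = id := by
    intro τ hτ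
    funext x
    have h1 : ∀ x, τ x ≤ x := fun x => by
      by_contra hn
      exact hs1' x (by rw [← hτ.2.1, letter_eq_one]; omega)
    have h2 := h1 (τ x)
    rw [hτ.1] at h2
    exact le_antisymm (h1 x) h2
  split_ifs with h
  · rw [Set.ncard_eq_one]
    refine ⟨id, Set.eq_singleton_iff_unique_mem.2 ⟨⟨fun x => rfl, fun x => ?_, fun v hv S hS => ?_⟩,
      hid⟩⟩
    · rw [letter_eq_zero.2 rfl]
      by_cases hx : x < N
      · exact (h.1 x hx).symm
      · exact (hs x (by omega)).symm
    · have : S = ∅ := Finset.eq_empty_of_forall_notMem fun x hx => by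
        have := hS.1 x hx
        simp only [id] at this
        omega
      rw [this]
      exact h.2 v hv
  · have : boundedMatchings N s c = ∅ := Set.eq_empty_of_forall_notMem fun τ hτ => h ⟨?_, ?_⟩
    · rw [this, Set.ncard_empty]
    · intro i _
      rw [← hτ.2.1, letter_eq_zero, hid τ hτ]; rfl
    · intro v hv
      exact hτ.2.2 v hv ∅ ⟨by simp, fun x hx => absurd hx (by simp)⟩

lemma sum_one_positions_lt {N a : ℕ} {s s' : ℕ → SignType} (haN : a + 2 ≤ N) (ha : s a = 1)
    (hs : ∀ i, i ≠ a → i ≠ a + 1 → s' i = s i) (ha' : s' a ≠ 1) :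
    ∑ i ∈ Finset.range N, (if s' i = 1 then N - i else 0) <
      ∑ i ∈ Finset.range N, if s i = 1 then N - i else 0 := by
  obtain ⟨r, rfl⟩ := Nat.exists_eq_add_of_le haN
  have h1 : ∑ i ∈ Finset.range a, (if s' i = 1 then a + 2 + r - i else 0) =
      ∑ i ∈ Finset.range a, if s i = 1 then a + 2 + r - i else 0 :=
    Finset.sum_congr rfl fun i hi => by
      rw [Finset.mem_range] at hi
      rw [hs i (by omega) (by omega)]
  have h2 : ∑ i ∈ Finset.range r, (if s' (a + 2 + i) = 1 then a + 2 + r - (a + 2 + i) else 0) =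
      ∑ i ∈ Finset.range r, if s (a + 2 + i) = 1 then a + 2 + r - (a + 2 + i) else 0 :=
    Finset.sum_congr rfl fun i _ => by rw [hs (a + 2 + i) (by omega) (by omega)]
  rw [Finset.sum_range_add, Finset.sum_range_add _ (a + 2), h2, Finset.sum_range_succ,
    Finset.sum_range_succ, Finset.sum_range_succ _ (a + 1), Finset.sum_range_succ _ a, h1,
    if_neg ha', if_pos ha]
  split_ifs <;> omega

/-- Matchings with bounded nestings are equinumerous with walks of partitions. -/
theorem ncard_boundedMatchings {ℓ N : ℕ} (s : ℕ → SignType) (c : ℕ → ℕ)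
    (hs : ∀ x, N ≤ x → s x = 0) (hc : ∀ v, c v ≤ ℓ + 1) :
    (boundedMatchings N s c).ncard = walkCount ℓ s c N 0 := by
  by_cases h1 : ∀ i < N, s i ≠ 1
  · rw [ncard_boundedMatchings_of_ne_one hs h1, walkCount_of_ne_one h1]
    simp
  push Not at h1
  obtain ⟨a, haN, ha, hlast⟩ : ∃ a < N, s a = 1 ∧ ∀ i, a < i → s i ≠ 1 := by
    obtain ⟨i, hi, hi1⟩ := h1
    have hne : ((Finset.range N).filter fun i => s i = 1).Nonempty := ⟨i, by simp [hi, hi1]⟩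
    have hmem := Finset.max'_mem _ hne
    rw [Finset.mem_filter, Finset.mem_range] at hmem
    refine ⟨_, hmem.1, hmem.2, fun j hj hj1 => ?_⟩
    by_cases hjN : j < N
    · exact absurd (Finset.le_max' _ j (by simp [hjN, hj1])) (not_le.2 hj)
    · rw [hs j (by omega)] at hj1
      exact absurd hj1 (by decide)
  rcases (show a + 2 ≤ N ∨ N = a + 1 by omega) with haN | rfl
  · have hswap : ∀ x, N ≤ x → (s ∘ Equiv.swap a (a + 1)) x = 0 := fun x hx => by
      simp [swap_apply_of_far (Or.inr (haN.trans hx)), hs x hx]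
    have hspread : ∀ v, spreadBound a c v ≤ ℓ + 1 := fun v => by
      unfold spreadBound; split_ifs
      · exact (min_le_left _ _).trans (hc v)
      · exact hc v
    have hb : s (a + 1) = 0 ∨ s (a + 1) = -1 := by
      have := hlast (a + 1) (by omega)
      revert this; generalize s (a + 1) = e; revert e; decide
    rcases hb with hb | hb
    · rw [ncard_boundedMatchings_swap haN ha hb, walkCount_swap haN ha hb]
      exact ncard_boundedMatchings _ _ hswap hspread
    · rw [ncard_boundedMatchings_cut hs haN ha hb, walkCount_cut haN (hc _) ha hb]
      congr 1
      · exact ncard_boundedMatchings _ _ hswap hspread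
      · refine ncard_boundedMatchings _ _ (fun x hx => ?_) fun v => ?_
        · rw [Function.update_of_ne (by omega), Function.update_of_ne (by omega), hs x hx]
        · by_cases hv : v = a + 1
          · subst hv; rw [Function.update_self]; exact (Nat.sub_le _ _).trans (hc _)
          · rw [Function.update_of_ne hv]; exact hc v
  · have : boundedMatchings (a + 1) s c = ∅ := Set.eq_empty_of_forall_notMem fun τ hτ => by
      have h2 := letter_eq_one.1 ((hτ.2.1 a).trans ha)
      have h3 := apply_lt_of_mem_boundedMatchings hs hτ (Nat.lt_succ_self a)
      omega
    rw [this, Set.ncard_empty, walkCount, ha, chamberRestrict, walkStep, if_pos rfl, sumDecr]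
    split_ifs
    · refine (Finset.sum_eq_zero fun i _ => ?_).symm
      by_contra hne
      have := (chamber_of_walkCount_ne_zero hne).nonneg i
      rw [sub_single_apply, if_pos rfl] at this
      simp only [Pi.zero_apply] at this
      omega
    · rfl
termination_by ∑ i ∈ Finset.range N, if s i = 1 then N - i else 0
decreasing_by
  · exact sum_one_positions_lt haN ha
      (fun i h h' => congrArg s (Equiv.swap_apply_of_ne_of_ne h h')) (by simp [hb])
  · exact sum_one_positions_lt haN ha
      (fun i h h' => congrArg s (Equiv.swap_apply_of_ne_of_ne h h')) (by simp [hb])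
  · exact sum_one_positions_lt haN ha
      (fun i h h' => by rw [Function.update_of_ne h', Function.update_of_ne h]) (by simp)

/-- The bounds on nestings that exclude decreasing subsequences of length `2ℓ+1`. -/
def strictBound (ℓ : ℕ) (s : ℕ → SignType) : ℕ → ℕ
  | 0 => ℓ + 1
  | v + 1 => if s v = 0 then ℓ else ℓ + 1

lemma strictBound_le (ℓ : ℕ) (s : ℕ → SignType) (v : ℕ) : strictBound ℓ s v ≤ ℓ + 1 := by
  cases v with
  | zero => exact le_rfl
  | succ v => rw [strictBound]; split_ifs <;> omega

lemma Nested.strictAntiOn_union {τ : ℕ → ℕ} (hτ : Function.Involutive τ) {v : ℕ}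
    {S F : Finset ℕ} (h : Nested τ v S) (hF : ∀ f ∈ F, τ f = f ∧ f + 1 = v) :
    StrictAntiOn τ ↑(S ∪ F ∪ S.image τ) ∧
      (S ∪ F ∪ S.image τ).card = 2 * S.card + F.card := by
  obtain ⟨h1, h2⟩ := h
  have hf : ∀ f ∈ F, ∀ x ∈ S, x < f ∧ f < τ x := fun f hf x hx => by
    obtain ⟨hf1, hf2⟩ := hF f hf
    have hx1 := h1 x hx
    refine ⟨?_, by omega⟩
    rcases Nat.lt_or_ge x f with h | h
    · exact h
    · have : x = f := by omega
      subst this; omega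
  have hfix : ∀ f ∈ F, ∀ g ∈ F, f = g := fun f hf g hg => by
    have := (hF f hf).2; have := (hF g hg).2; omega
  have hd : ∀ x ∈ S, ∀ y ∈ S, x < τ y := fun x hx y hy =>
    (h1 x hx).1.trans_le (h1 y hy).2
  have h2' : ∀ x ∈ S, ∀ y ∈ S, x < y → τ y < τ x := fun x hx y hy hxy => h2 hx hy hxy
  constructor
  · intro a ha b hb hab
    simp only [Finset.coe_union, Finset.coe_image, Set.mem_union, Finset.mem_coe,
      Set.mem_image] at ha hb
    rcases ha with (ha | ha) | ⟨x, hx, rfl⟩ <;> rcases hb with (hb | hb) | ⟨y, hy, rfl⟩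
    · exact h2 ha hb hab
    · rw [(hF b hb).1]; exact (hf b hb a ha).2
    · rw [hτ]; exact hd y hy a ha
    · have := hf a ha b hb; omega
    · have := hfix a ha b hb; omega
    · rw [hτ, (hF a ha).1]; exact (hf a ha y hy).1
    · have := hd b hb x hx; omega
    · have := hf b hb x hx; omega
    · rw [hτ, hτ]
      by_contra hn
      rcases Nat.eq_or_lt_of_le (not_lt.1 hn) with h | h
      · subst h; omega
      · have := h2' x hx y hy h; omega
  · rw [Finset.card_union_of_disjoint, Finset.card_union_of_disjoint,
      Finset.card_image_of_injective _ hτ.injective]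
    · ring
    · exact Finset.disjoint_left.2 fun x hx hx' => (hf x hx' x hx).1.ne rfl
    · refine Finset.disjoint_left.2 fun x hx hx' => ?_
      obtain ⟨y, hy, rfl⟩ := Finset.mem_image.1 hx'
      rcases Finset.mem_union.1 hx with h | h
      · exact (hd _ h y hy).ne rfl
      · exact (hf _ h y hy).2.ne rfl

lemma exists_nested_openers {τ : ℕ → ℕ} {P : Finset ℕ} (hP : StrictAntiOn τ ↑P)
    (h : ∀ x ∈ P, x < τ x) : ∃ v, Nested τ v P := by
  rcases P.eq_empty_or_nonempty with rfl | hne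
  · exact ⟨0, by simp, hP⟩
  · refine ⟨P.max' hne + 1, fun x hx => ?_, hP⟩
    have h1 := P.le_max' x hx
    have h2 := hP.antitoneOn hx (P.max'_mem hne) h1
    have h3 := h _ (P.max'_mem hne)
    omega

lemma exists_nested_closers {τ : ℕ → ℕ} (hτ : Function.Involutive τ) {P : Finset ℕ}
    (hP : StrictAntiOn τ ↑P) (h : ∀ x ∈ P, τ x < x) : ∃ v, Nested τ v (P.image τ) := by
  apply exists_nested_openers
  · intro a ha b hb hab
    simp only [Finset.coe_image, Set.mem_image, Finset.mem_coe] at ha hb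
    obtain ⟨x, hx, rfl⟩ := ha
    obtain ⟨y, hy, rfl⟩ := hb
    rw [hτ, hτ]
    by_contra hn
    exact absurd (hP.antitoneOn hx hy (not_lt.1 hn)) (not_le.2 hab)
  · intro y hy
    obtain ⟨x, hx, rfl⟩ := Finset.mem_image.1 hy
    rw [hτ]; exact h x hx

/-- Decreasing subsequences of length `2ℓ+1` of an involution, in terms of nestings. -/
lemma forall_nestLT_strictBound_iff {τ : ℕ → ℕ} (hτ : Function.Involutive τ) (ℓ : ℕ) :
    (∀ v, NestLT τ v (strictBound ℓ (letter τ) v)) ↔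
      ∀ T : Finset ℕ, StrictAntiOn τ ↑T → T.card ≠ 2 * ℓ + 1 := by
  constructor
  · intro h T hT hcard
    have hle : ∀ v S, Nested τ v S → S.card ≤ ℓ := fun v S hS =>
      Nat.lt_succ_iff.1 ((h v S hS).trans_le (strictBound_le _ _ _))
    set P := T.filter fun x => x < τ x with hP
    set M := T.filter fun x => τ x < x with hM
    set Z := T.filter fun x => τ x = x with hZ
    have hsub : ∀ S : Finset ℕ, S ⊆ T → StrictAntiOn τ ↑S := fun S hS =>
      hT.mono (by exact_mod_cast hS)
    obtain ⟨v, hv⟩ := exists_nested_openers (hsub P (Finset.filter_subset _ _))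
      fun x hx => (Finset.mem_filter.1 hx).2
    obtain ⟨w, hw⟩ := exists_nested_closers hτ (hsub M (Finset.filter_subset _ _))
      fun x hx => (Finset.mem_filter.1 hx).2
    have hPc := hle v P hv
    have hMc := hle w _ hw
    rw [Finset.card_image_of_injective _ hτ.injective] at hMc
    have hZc : Z.card ≤ 1 := Finset.card_le_one.2 fun a ha b hb => by
      rw [hZ, Finset.mem_filter] at ha hb
      rcases lt_trichotomy a b with hab | hab | hab
      · have := hT ha.1 hb.1 hab; omega
      · exact hab
      · have := hT hb.1 ha.1 hab; omega
    have hsum : T.card = P.card + M.card + Z.card := by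
      simp only [hP, hM, hZ, Finset.card_filter, Finset.card_eq_sum_ones T,
        ← Finset.sum_add_distrib]
      refine Finset.sum_congr rfl fun x _ => ?_
      split_ifs <;> omega
    obtain ⟨f, hf⟩ : Z.Nonempty := Finset.card_pos.1 (by omega)
    rw [hZ, Finset.mem_filter] at hf
    have hn : Nested τ (f + 1) P := by
      refine ⟨fun x hx => ?_, hsub P (Finset.filter_subset _ _)⟩
      rw [hP, Finset.mem_filter] at hx
      rcases lt_trichotomy x f with hab | hab | hab
      · have := hT hx.1 hf.1 hab; omega
      · subst hab; omega
      · have := hT hf.1 hx.1 hab; omega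
    have := h _ _ hn
    rw [strictBound, if_pos (letter_eq_zero.2 hf.2)] at this
    omega
  · intro h v S hS
    by_contra hn
    have key : ∀ F : Finset ℕ, (∀ f ∈ F, τ f = f ∧ f + 1 = v) →
        2 * S.card + F.card < 2 * ℓ + 1 := by
      intro F hF
      obtain ⟨h1, h2⟩ := hS.strictAntiOn_union hτ hF
      by_contra hlt
      obtain ⟨T, hT, hTc⟩ := Finset.exists_subset_card_eq (h2 ▸ not_lt.1 hlt)
      exact h T (h1.mono (by exact_mod_cast hT)) hTc
    cases v with
    | zero =>
      have := key ∅ (by simp)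
      rw [strictBound] at hn
      simp only [Finset.card_empty] at this
      omega
    | succ v =>
      rw [strictBound] at hn
      split_ifs at hn with h0
      · have := key {v} (by simpa using letter_eq_zero.1 h0)
        simp only [Finset.card_singleton] at this
        omega
      · have := key ∅ (by simp)
        simp only [Finset.card_empty] at this
        omega

/-- A self-map of `Fin n`, extended to `ℕ` by the identity. -/
def extendMap {n : ℕ} (f : Fin n → Fin n) (x : ℕ) : ℕ :=
  if h : x < n then f ⟨x, h⟩ else x

/-- A word of length `n`, extended by zeros. -/
def extendWord {n : ℕ} (s : Fin n → SignType) (x : ℕ) : SignType :=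
  if h : x < n then s ⟨x, h⟩ else 0

lemma extendMap_coe {n : ℕ} (f : Fin n → Fin n) (i : Fin n) : extendMap f i = f i := by
  simp [extendMap]

lemma extendMap_of_le {n x : ℕ} (f : Fin n → Fin n) (h : n ≤ x) : extendMap f x = x := by
  simp [extendMap, not_lt.2 h]

lemma extendWord_coe {n : ℕ} (s : Fin n → SignType) (i : Fin n) : extendWord s i = s i := by
  simp [extendWord]

lemma extendWord_of_le {n x : ℕ} (s : Fin n → SignType) (h : n ≤ x) : extendWord s x = 0 := by
  simp [extendWord, not_lt.2 h]

lemma involutive_extendMap {n : ℕ} {f : Fin n → Fin n} (h : Function.Involutive f) :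
    Function.Involutive (extendMap f) := fun x => by
  by_cases hx : x < n
  · have := extendMap_coe f ⟨x, hx⟩
    simp only at this
    rw [this, extendMap_coe, h]
  · rw [extendMap_of_le f (not_lt.1 hx), extendMap_of_le f (not_lt.1 hx)]

lemma hasDescSeq_iff {n : ℕ} (f : Fin n → Fin n) {k : ℕ} (hk : 2 ≤ k) :
    HasDescSeq f k ↔ ∃ T : Finset ℕ, StrictAntiOn (extendMap f) ↑T ∧ T.card = k := by
  constructor
  · rintro ⟨s, hs, hf⟩
    refine ⟨Finset.univ.image fun a => (s a : ℕ), ?_, ?_⟩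
    · intro x hx y hy hxy
      simp only [Finset.coe_image, Finset.coe_univ, Set.image_univ, Set.mem_range] at hx hy
      obtain ⟨a, rfl⟩ := hx
      obtain ⟨b, rfl⟩ := hy
      rw [extendMap_coe, extendMap_coe]
      exact hf (hs.lt_iff_lt.1 hxy)
    · rw [Finset.card_image_of_injective _ fun a b h => hs.injective (Fin.ext h),
        Finset.card_univ, Fintype.card_fin]
  · rintro ⟨T, hT, hc⟩
    have hTn : ∀ y ∈ T, y < n := by
      intro y hy
      by_contra hn
      obtain ⟨x, hx, hxy⟩ : ∃ x ∈ T, x ≠ y := by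
        by_contra! hall
        have : T.card ≤ 1 := Finset.card_le_one.2 fun a ha b hb =>
          (hall a ha).trans (hall b hb).symm
        omega
      have hlt : ∀ x, x < n → extendMap f x < n := fun x hx => by
        have := extendMap_coe f ⟨x, hx⟩
        simp only at this
        rw [this]; exact Fin.is_lt _
      have h2 := extendMap_of_le f (not_lt.1 hn)
      rcases Nat.lt_or_ge x n with h | h
      · have := hT hx hy (by omega)
        have := hlt x h
        omega
      · have h1 := extendMap_of_le f h
        rcases lt_or_gt_of_ne hxy with h' | h'
        · have := hT hx hy h'; omega
        · have := hT hy hx h'; omega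
    refine ⟨fun a => ⟨T.orderEmbOfFin hc a, hTn _ (T.orderEmbOfFin_mem hc a)⟩, fun a b hab => ?_,
      fun a b hab => ?_⟩
    · exact (T.orderEmbOfFin hc).strictMono hab
    · have := hT (T.orderEmbOfFin_mem hc a) (T.orderEmbOfFin_mem hc b)
        ((T.orderEmbOfFin hc).strictMono hab)
      rw [Fin.lt_def, ← extendMap_coe f, ← extendMap_coe f]
      exact this

lemma extendMap_mem_boundedMatchings_iff {n ℓ : ℕ} (hl : 1 ≤ ℓ) (τ : Equiv.Perm (Fin n))
    (s : Fin n → SignType) :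
    extendMap τ ∈ boundedMatchings n (extendWord s) (strictBound ℓ (extendWord s)) ↔
      (Function.Involutive τ ∧ ¬ HasDescSeq τ (2 * ℓ + 1)) ∧
        (fun i : Fin n => letter (extendMap τ) i) = s := by
  have hword : (∀ x, letter (extendMap τ) x = extendWord s x) ↔
      (fun i : Fin n => letter (extendMap τ) i) = s := by
    constructor
    · intro h
      funext i
      rw [h, extendWord_coe]
    · rintro rfl x
      by_cases hx : x < n
      · simp [extendWord, hx]
      · rw [extendWord_of_le _ (not_lt.1 hx), letter_eq_zero, extendMap_of_le _ (not_lt.1 hx)]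
  have hinv : Function.Involutive (extendMap τ) ↔ Function.Involutive τ := by
    refine ⟨fun h i => Fin.ext ?_, involutive_extendMap⟩
    rw [← extendMap_coe τ, ← extendMap_coe τ, h]
  rw [boundedMatchings, Set.mem_ofPred_eq, hword, hinv, and_assoc]
  refine and_congr_right fun hi => ?_
  rw [and_comm]
  refine and_congr_left fun hw => ?_
  have hw' : letter (extendMap τ) = extendWord s := funext (hword.2 hw)
  rw [hasDescSeq_iff _ (by omega), ← hw']
  push Not
  rw [← forall_nestLT_strictBound_iff (hinv.2 hi)]
  refine ⟨fun h v => ?_, fun h v _ => h v⟩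
  by_cases hv : v ≤ n
  · exact h v hv
  · intro S hS
    have : S = ∅ := Finset.eq_empty_of_forall_notMem fun x hx => by
      have h1 := hS.1 x hx
      have h2 := hinv.2 hi x
      rw [extendMap_of_le (x := extendMap τ x) _ (by omega)] at h2
      omega
    rw [this, Finset.card_empty]
    cases v with
    | zero => omega
    | succ v => rw [strictBound]; split_ifs <;> omega

lemma image_extendMap_eq {n ℓ : ℕ} (hl : 1 ≤ ℓ) (s : Fin n → SignType) :
    Set.image (fun τ : Equiv.Perm (Fin n) => extendMap τ)
      {τ | (Function.Involutive τ ∧ ¬ HasDescSeq τ (2 * ℓ + 1)) ∧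
        (fun i : Fin n => letter (extendMap τ) i) = s} =
      boundedMatchings n (extendWord s) (strictBound ℓ (extendWord s)) := by
  ext g
  constructor
  · rintro ⟨τ, hτ, rfl⟩
    exact (extendMap_mem_boundedMatchings_iff hl τ s).2 hτ
  · intro hg
    have hlt : ∀ x, x < n → g x < n := fun x hx =>
      apply_lt_of_mem_boundedMatchings (fun x hx => extendWord_of_le s hx) hg hx
    let σ : Equiv.Perm (Fin n) := Function.Involutive.toPerm (fun i => ⟨g i, hlt i i.2⟩)
      fun i => Fin.ext (hg.1 i)
    have hσ : extendMap σ = g := by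
      funext x
      by_cases hx : x < n
      · exact extendMap_coe σ ⟨x, hx⟩
      · rw [extendMap_of_le _ (not_lt.1 hx)]
        have := hg.2.1 x
        rw [extendWord_of_le s (not_lt.1 hx), letter_eq_zero] at this
        exact this.symm
    exact ⟨σ, (extendMap_mem_boundedMatchings_iff hl σ s).1 (hσ ▸ hg), hσ⟩

lemma card_involutions_eq_walkCount {n ℓ : ℕ} (hl : 1 ≤ ℓ) (s : Fin n → SignType) :
    (Finset.univ.filter fun τ : Equiv.Perm (Fin n) =>
      (Function.Involutive τ ∧ ¬ HasDescSeq τ (2 * ℓ + 1)) ∧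
        (fun i : Fin n => letter (extendMap τ) i) = s).card =
      walkCount ℓ (extendWord s) (strictBound ℓ (extendWord s)) n 0 := by
  rw [← ncard_boundedMatchings _ _ (fun x hx => extendWord_of_le s hx) (strictBound_le _ _),
    ← image_extendMap_eq hl, Set.ncard_image_of_injective]
  · rw [← Set.ncard_coe_finset]
    congr 1
    ext τ
    simp
  · intro τ σ h
    ext i
    have := congrFun h i
    simpa [extendMap_coe] using this

/-- Involutions without long decreasing subsequences, counted by words of signs. -/
lemma invCountFix_eq_sum {ℓ : ℕ} (hl : 1 ≤ ℓ) (p n : ℕ) :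
    invCountFix (2 * ℓ) p n =
      ∑ s : Fin n → SignType, if (Finset.univ.filter fun i => s i = 0).card = p then
        walkCount ℓ (extendWord s) (strictBound ℓ (extendWord s)) n 0 else 0 := by
  have hfix : ∀ τ : Equiv.Perm (Fin n),
      (Finset.univ.filter fun i : Fin n => letter (extendMap τ) i = 0) =
        Finset.univ.filter fun x => τ x = x := fun τ => by
    ext i
    simp [letter_eq_zero, extendMap_coe, Fin.ext_iff]
  rw [invCountFix, Nat.card_eq_fintype_card, Fintype.card_subtype,
    Finset.card_eq_sum_card_fiberwise
      (f := fun τ : Equiv.Perm (Fin n) => fun i : Fin n => letter (extendMap τ) i)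
      (t := Finset.univ) (by simp [Set.MapsTo])]
  refine Finset.sum_congr rfl fun s _ => ?_
  rw [Finset.filter_filter]
  split_ifs with hp
  · rw [← card_involutions_eq_walkCount hl]
    congr 1
    ext τ
    simp only [Finset.mem_filter, Finset.mem_univ, true_and]
    constructor
    · rintro ⟨⟨h1, h2, _⟩, h4⟩
      exact ⟨⟨h1, h2⟩, h4⟩
    · rintro ⟨⟨h1, h2⟩, rfl⟩
      exact ⟨⟨h1, h2, by rw [← hfix]; exact hp⟩, rfl⟩
  · rw [Finset.card_eq_zero, Finset.filter_eq_empty_iff]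
    rintro τ - ⟨⟨_, _, h3⟩, rfl⟩
    exact hp (by rw [hfix]; exact h3)

/-- Walks of partitions with at most `ℓ` parts whose steps add a box, remove a box, or stay at a
partition with fewer than `ℓ` parts; the exponent of the variable counts the idle steps. -/
def walkGF (ℓ : ℕ) : ℕ → (ℕ → ℤ) → PowerSeries ℚ
  | 0 => chamberRestrict (ℓ + 1) fun x => if x = 0 then 1 else 0
  | n + 1 => chamberRestrict (ℓ + 1) (sumDecr ℓ (walkGF ℓ n) + sumIncr ℓ (walkGF ℓ n)) +
      (PowerSeries.X : PowerSeries ℚ) • chamberRestrict ℓ (walkGF ℓ n)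

lemma walkCount_extendWord_snoc (ℓ : ℕ) {n : ℕ} (ε : SignType) (s : Fin n → SignType) :
    walkCount ℓ (extendWord (Fin.snoc s ε : Fin (n + 1) → SignType))
        (strictBound ℓ (extendWord (Fin.snoc s ε : Fin (n + 1) → SignType))) (n + 1) =
      chamberRestrict (if ε = 0 then ℓ else ℓ + 1)
        (walkStep ℓ ε (walkCount ℓ (extendWord s) (strictBound ℓ (extendWord s)) n)) := by
  have h1 : extendWord (Fin.snoc s ε : Fin (n + 1) → SignType) n = ε := by
    simp [extendWord, Fin.snoc]
  have h2 : ∀ i < n, extendWord (Fin.snoc s ε : Fin (n + 1) → SignType) i = extendWord s i :=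
    fun i hi => by simp [extendWord, Fin.snoc, hi, Nat.lt_succ_of_lt hi]
  rw [walkCount, strictBound, h1]
  congr 2
  refine walkCount_congr h2 fun i hi => ?_
  cases i with
  | zero => rfl
  | succ i => rw [strictBound, strictBound, h2 i hi]

lemma walkGF_eq_sum (ℓ n : ℕ) (x : ℕ → ℤ) :
    walkGF ℓ n x = ∑ s : Fin n → SignType,
      (∏ i, if s i = 0 then (PowerSeries.X : PowerSeries ℚ) else 1) *
        (walkCount ℓ (extendWord s) (strictBound ℓ (extendWord s)) n x : PowerSeries ℚ) := by
  induction n generalizing x with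
  | zero =>
    simp only [walkGF, chamberRestrict, Finset.univ_unique, Finset.sum_singleton,
      Finset.univ_eq_empty, Finset.prod_empty, walkCount, strictBound]
    by_cases h : Chamber (ℓ + 1) x <;> by_cases hx : x = 0 <;> simp [h, hx]
  | succ n ih =>
    rw [← (Fin.snocEquiv fun _ : Fin (n + 1) => SignType).sum_comp, Fintype.sum_prod_type,
      show (Finset.univ : Finset SignType) = {0, -1, 1} from rfl,
      Finset.sum_insert (by decide), Finset.sum_insert (by decide), Finset.sum_singleton]
    simp only [Fin.snocEquiv, Equiv.coe_fn_mk, Fin.prod_univ_castSucc, Fin.snoc_castSucc,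
      Fin.snoc_last, walkCount_extendWord_snoc]
    have e1 : ∀ f, walkStep ℓ 1 f = sumDecr ℓ f := fun f => by simp [walkStep]
    have e0 : ∀ f, walkStep ℓ 0 f = f := fun f => by simp [walkStep]
    have em : ∀ f, walkStep ℓ (-1) f = sumIncr ℓ f := fun f => by
      rw [walkStep, if_neg (by decide), if_pos rfl]
    simp only [e0, e1, em, if_true, show ((-1 : SignType) = 0) = False by decide,
      show ((1 : SignType) = 0) = False by decide, if_false, mul_one]
    have hd : (∑ s : Fin n → SignType, (∏ i, if s i = 0 then (PowerSeries.X : PowerSeries ℚ) else 1)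
        * ((sumDecr ℓ (walkCount ℓ (extendWord s) (strictBound ℓ (extendWord s)) n) x : ℕ) :
          PowerSeries ℚ)) = sumDecr ℓ (walkGF ℓ n) x := by
      simp only [sumDecr, ih, Nat.cast_sum, Finset.mul_sum]
      exact Finset.sum_comm
    have hi : (∑ s : Fin n → SignType, (∏ i, if s i = 0 then (PowerSeries.X : PowerSeries ℚ) else 1)
        * ((sumIncr ℓ (walkCount ℓ (extendWord s) (strictBound ℓ (extendWord s)) n) x : ℕ) :
          PowerSeries ℚ)) = sumIncr ℓ (walkGF ℓ n) x := by
      simp only [sumIncr, ih, Nat.cast_sum, Finset.mul_sum]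
      exact Finset.sum_comm
    simp only [walkGF, Pi.add_apply, Pi.smul_apply, smul_eq_mul, chamberRestrict]
    rw [add_comm]
    congr 1
    · split_ifs
      · rw [ih, Finset.mul_sum]
        exact Finset.sum_congr rfl fun s _ => by ring
      · simp
    · split_ifs
      · rw [hd, hi, add_comm]
      · simp

lemma coeff_walkGF {ℓ : ℕ} (hl : 1 ≤ ℓ) (p n : ℕ) :
    PowerSeries.coeff p (walkGF ℓ n 0) = invCountFix (2 * ℓ) p n := by
  rw [walkGF_eq_sum, map_sum, invCountFix_eq_sum hl, Nat.cast_sum]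
  refine Finset.sum_congr rfl fun s _ => ?_
  rw [Finset.prod_ite, Finset.prod_const, Finset.prod_const_one, mul_one,
    ← map_natCast (PowerSeries.C (R := ℚ)), PowerSeries.coeff_mul_C, PowerSeries.coeff_X_pow]
  split_ifs with h1 h2 h2
  · simp
  · exact absurd h1.symm (by convert h2)
  · exact absurd h2.symm (by convert h1)
  · simp

lemma coeff_besselI_add (a b : ℕ) :
    PowerSeries.coeff (a + b) (besselI ((b : ℤ) - a)) =
      1 / ((a.factorial : ℚ) * (b.factorial : ℚ)) := by
  rw [besselI, PowerSeries.coeff_mk, if_pos ⟨by push_cast; omega, by push_cast; omega, by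
    push_cast; omega⟩]
  rw [show ((((a + b : ℕ) : ℤ) - (b - a)) / 2).toNat = a by push_cast; omega,
    show ((((a + b : ℕ) : ℤ) + (b - a)) / 2).toNat = b by push_cast; omega]

lemma coeff_besselI_eq_zero {N : ℕ} {i : ℤ}
    (h : ¬ (0 ≤ (N : ℤ) - i ∧ 0 ≤ (N : ℤ) + i ∧ 2 ∣ ((N : ℤ) - i))) :
    PowerSeries.coeff N (besselI i) = 0 := by
  rw [besselI, PowerSeries.coeff_mk, if_neg h]

lemma besselI_neg (i : ℤ) : besselI (-i) = besselI i := by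
  ext N
  by_cases h : 0 ≤ (N : ℤ) - i ∧ 0 ≤ (N : ℤ) + i ∧ 2 ∣ ((N : ℤ) - i)
  · obtain ⟨h1, h2, k, hk⟩ := h
    obtain ⟨a, ha⟩ := Int.eq_ofNat_of_zero_le (show 0 ≤ k by omega)
    obtain ⟨b, hb⟩ := Int.eq_ofNat_of_zero_le (show 0 ≤ k + i by omega)
    obtain rfl : N = a + b := by omega
    obtain rfl : i = (b : ℤ) - a := by omega
    rw [coeff_besselI_add, neg_sub, add_comm, coeff_besselI_add, mul_comm]
  · rw [coeff_besselI_eq_zero h, coeff_besselI_eq_zero (by omega)]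

lemma coeff_succ_besselI (N : ℕ) (i : ℤ) :
    PowerSeries.coeff (N + 1) (besselI i) * ((N : ℚ) + 1) =
      PowerSeries.coeff N (besselI (i - 1)) + PowerSeries.coeff N (besselI (i + 1)) := by
  by_cases h : 0 ≤ ((N + 1 : ℕ) : ℤ) - i ∧ 0 ≤ ((N + 1 : ℕ) : ℤ) + i ∧
      2 ∣ (((N + 1 : ℕ) : ℤ) - i)
  · obtain ⟨h1, h2, k, hk⟩ := h
    obtain ⟨a, ha⟩ := Int.eq_ofNat_of_zero_le (show 0 ≤ k by omega)
    obtain ⟨b, hb⟩ := Int.eq_ofNat_of_zero_le (show 0 ≤ k + i by omega)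
    have hN : N + 1 = a + b := by omega
    obtain rfl : i = (b : ℤ) - a := by omega
    have hc : (N : ℚ) + 1 = a + b := by exact_mod_cast hN
    rw [hN, coeff_besselI_add, hc]
    have e1 : PowerSeries.coeff N (besselI ((b : ℤ) - a - 1)) =
        b / ((a.factorial : ℚ) * (b.factorial : ℚ)) := by
      cases b with
      | zero => rw [coeff_besselI_eq_zero (by omega)]; simp
      | succ b =>
        obtain rfl : N = a + b := by omega
        rw [show ((b + 1 : ℕ) : ℤ) - a - 1 = b - a by push_cast; ring, coeff_besselI_add,
          Nat.factorial_succ]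
        have := Nat.factorial_ne_zero a
        have := Nat.factorial_ne_zero b
        push_cast
        field_simp
    have e2 : PowerSeries.coeff N (besselI ((b : ℤ) - a + 1)) =
        a / ((a.factorial : ℚ) * (b.factorial : ℚ)) := by
      cases a with
      | zero => rw [coeff_besselI_eq_zero (by omega)]; simp
      | succ a =>
        obtain rfl : N = a + b := by omega
        rw [show (b : ℤ) - ((a + 1 : ℕ) : ℤ) + 1 = b - a by push_cast; ring, coeff_besselI_add,
          Nat.factorial_succ]
        have := Nat.factorial_ne_zero a
        have := Nat.factorial_ne_zero b
        push_cast
        field_simp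
    rw [e1, e2]
    ring
  · rw [coeff_besselI_eq_zero h, coeff_besselI_eq_zero (by omega),
      coeff_besselI_eq_zero (by omega)]
    simp

/-- The series `∑ₖ qᵏ (I_{x+k-b} - I_{x+k+b})`, as a power series in `t` over `ℚ⟦q⟧`. -/
def reflectedSeries (b x : ℤ) : PowerSeries (PowerSeries ℚ) :=
  PowerSeries.mk fun n => PowerSeries.mk fun k : ℕ =>
    PowerSeries.coeff n (besselI (x + k - b) - besselI (x + k + b))

lemma coeff_reflectedSeries (b x : ℤ) (n k : ℕ) :
    PowerSeries.coeff k (PowerSeries.coeff n (reflectedSeries b x)) =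
      PowerSeries.coeff n (besselI (x + k - b) - besselI (x + k + b)) := by
  simp [reflectedSeries]

/-- The formal derivative as an additive map. -/
def formalDeriv {R : Type*} [CommRing R] : PowerSeries R →+ PowerSeries R :=
  (PowerSeries.derivative R).toLinearMap.toAddMonoidHom

lemma coeff_formalDeriv {R : Type*} [CommRing R] (f : PowerSeries R) (n : ℕ) :
    PowerSeries.coeff n (formalDeriv f) = PowerSeries.coeff (n + 1) f * (n + 1) :=
  PowerSeries.coeff_derivative f n

lemma formalDeriv_reflectedSeries (b x : ℤ) :
    formalDeriv (reflectedSeries b x) =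
      reflectedSeries b (x + 1) + reflectedSeries b (x - 1) := by
  ext n k
  rw [coeff_formalDeriv, map_add, map_add, coeff_reflectedSeries,
    coeff_reflectedSeries, show ((n : PowerSeries ℚ) + 1) = PowerSeries.C ((n : ℚ) + 1) by simp,
    PowerSeries.coeff_mul_C, coeff_reflectedSeries, map_sub, map_sub, map_sub, sub_mul,
    coeff_succ_besselI, coeff_succ_besselI, show x + k - b - 1 = x - 1 + k - b by ring,
    show x + k - b + 1 = x + 1 + k - b by ring, show x + k + b - 1 = x - 1 + k + b by ring,
    show x + k + b + 1 = x + 1 + k + b by ring]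
  ring

lemma reflectedSeries_eq_add (b x : ℤ) :
    reflectedSeries b x = PowerSeries.map PowerSeries.C (besselI (x - b) - besselI (x + b)) +
      PowerSeries.C PowerSeries.X * reflectedSeries b (x + 1) := by
  ext n k
  rw [coeff_reflectedSeries, map_add, map_add, PowerSeries.coeff_C_mul, PowerSeries.coeff_map]
  cases k with
  | zero => simp
  | succ k =>
    rw [PowerSeries.coeff_succ_X_mul, coeff_reflectedSeries, PowerSeries.coeff_C,
      if_neg (Nat.succ_ne_zero k), zero_add]
    push_cast
    rw [show x + ((k : ℤ) + 1) = x + 1 + k by ring]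

lemma reflectedSeries_zero (b : ℤ) :
    reflectedSeries b 0 = PowerSeries.C PowerSeries.X * reflectedSeries b 1 := by
  rw [reflectedSeries_eq_add, zero_sub, zero_add, besselI_neg, sub_self, map_zero, zero_add,
    zero_add]

lemma map_prod_of_leibniz {A ι : Type*} [CommRing A] (D : A →+ A)
    (hD : ∀ a b, D (a * b) = a * D b + b * D a) (f : ι → A) (s : Finset ι) :
    D (∏ j ∈ s, f j) = ∑ i ∈ s, ∏ j ∈ s, if j = i then D (f j) else f j := by
  induction s using Finset.induction_on with
  | empty => simpa using hD 1 1
  | insert a s ha ih =>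
    rw [Finset.prod_insert ha, hD, ih, Finset.sum_insert ha, Finset.prod_insert ha,
      if_pos rfl, Finset.mul_sum, add_comm]
    congr 1
    · rw [mul_comm]
      congr 1
      exact Finset.prod_congr rfl fun j hj => by rw [if_neg (by rintro rfl; exact ha hj)]
    · refine Finset.sum_congr rfl fun i hi => ?_
      rw [Finset.prod_insert ha, if_neg (by rintro rfl; exact ha hi)]

lemma map_det_of_leibniz {A n : Type*} [CommRing A] [Fintype n] [DecidableEq n] (D : A →+ A)
    (hD : ∀ a b, D (a * b) = a * D b + b * D a) (M : Matrix n n A) :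
    D M.det = ∑ i, (M.updateRow i fun j => D (M i j)).det := by
  have h : ∀ N : Matrix n n A,
      N.det = ∑ σ : Equiv.Perm n, (Equiv.Perm.sign σ : ℤ) • ∏ i, N i (σ i) := fun N => by
    rw [← Matrix.det_transpose, Matrix.det_apply]
    rfl
  simp only [h, map_sum, map_zsmul, map_prod_of_leibniz D hD, Finset.smul_sum]
  rw [Finset.sum_comm]
  refine Finset.sum_congr rfl fun i _ => Finset.sum_congr rfl fun σ _ => ?_
  congr 1
  refine Finset.prod_congr rfl fun j _ => ?_
  rw [Matrix.updateRow_apply]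
  split_ifs with hj
  · rw [hj]
  · rfl

lemma formalDeriv_det {R n : Type*} [CommRing R] [Fintype n] [DecidableEq n]
    (M : Matrix n n (PowerSeries R)) :
    formalDeriv M.det = ∑ i, (M.updateRow i fun j => formalDeriv (M i j)).det :=
  map_det_of_leibniz formalDeriv (fun a b => (PowerSeries.derivative R).leibniz a b) M

/-- The determinant solving the reflected walk problem. -/
def reflectedMatrix (ℓ : ℕ) (x : ℕ → ℤ) :
    Matrix (Fin ℓ) (Fin ℓ) (PowerSeries (PowerSeries ℚ)) :=
  Matrix.of fun i j => reflectedSeries ((ℓ : ℤ) - j) (x i + ((ℓ : ℤ) - i))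

lemma updateRow_reflectedMatrix {ℓ : ℕ} (x y : ℕ → ℤ) (i : Fin ℓ)
    (h : ∀ k : ℕ, k ≠ i → y k = x k) :
    (reflectedMatrix ℓ x).updateRow i
      (fun j => reflectedSeries ((ℓ : ℤ) - j) (y i + ((ℓ : ℤ) - i))) = reflectedMatrix ℓ y := by
  ext1 k j
  rw [Matrix.updateRow_apply]
  split_ifs with hk
  · subst hk; rfl
  · simp only [reflectedMatrix, Matrix.of_apply]
    rw [h k fun h' => hk (Fin.ext h')]

lemma formalDeriv_det_reflectedMatrix (ℓ : ℕ) (x : ℕ → ℤ) :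
    formalDeriv (reflectedMatrix ℓ x).det =
      sumIncr ℓ (fun y => (reflectedMatrix ℓ y).det) x +
        sumDecr ℓ (fun y => (reflectedMatrix ℓ y).det) x := by
  rw [formalDeriv_det, sumIncr, sumDecr, Finset.sum_range, Finset.sum_range,
    ← Finset.sum_add_distrib]
  refine Finset.sum_congr rfl fun i _ => ?_
  rw [← updateRow_reflectedMatrix x (x + Pi.single (i : ℕ) 1) i
      (fun k hk => by rw [add_single_apply, if_neg hk, add_zero]),
    ← updateRow_reflectedMatrix x (x - Pi.single (i : ℕ) 1) i
      (fun k hk => by rw [sub_single_apply, if_neg hk, sub_zero]),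
    ← Matrix.det_updateRow_add]
  congr 2
  funext j
  rw [reflectedMatrix, Matrix.of_apply, formalDeriv_reflectedSeries, Pi.add_apply,
    add_single_apply, sub_single_apply, if_pos rfl,
    show x i + ((ℓ : ℤ) - i) + 1 = x i + 1 + (ℓ - i) by ring,
    show x i + ((ℓ : ℤ) - i) - 1 = x i - 1 + (ℓ - i) by ring]

lemma det_reflectedMatrix_eq_zero {ℓ : ℕ} {x : ℕ → ℤ} {i : ℕ} (hi : i + 1 < ℓ)
    (h : x (i + 1) = x i + 1) : (reflectedMatrix ℓ x).det = 0 := by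
  refine Matrix.det_zero_of_row_eq (i := ⟨i, by omega⟩) (j := ⟨i + 1, hi⟩)
    (fun h' => by simpa using congrArg Fin.val h') ?_
  funext j
  simp only [reflectedMatrix, Matrix.of_apply, h]
  congr 1
  push_cast
  ring

lemma det_reflectedMatrix_sub_single {ℓ : ℕ} {x : ℕ → ℤ} {i : ℕ} (hi : i + 1 = ℓ)
    (h : x i = 0) : (reflectedMatrix ℓ (x - Pi.single i 1)).det =
      PowerSeries.C PowerSeries.X * (reflectedMatrix ℓ x).det := by
  subst hi
  have e := Matrix.det_updateRow_smul (reflectedMatrix (i + 1) x) (Fin.last i)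
    (PowerSeries.C PowerSeries.X) fun j => reflectedSeries (((i + 1 : ℕ) : ℤ) - j)
      (x (Fin.last i : Fin (i + 1)) + (((i + 1 : ℕ) : ℤ) - (Fin.last i : Fin (i + 1))))
  rw [updateRow_reflectedMatrix x x (Fin.last i) fun k hk => rfl] at e
  rw [← e, ← updateRow_reflectedMatrix x (x - Pi.single i 1) (Fin.last i) fun k hk => by
    rw [Fin.val_last] at hk; rw [sub_single_apply, if_neg hk, sub_zero]]
  congr 2
  funext j
  rw [Pi.smul_apply, Fin.val_last, sub_single_apply, if_pos rfl, h, smul_eq_mul, zero_sub]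
  push_cast
  rw [show (-1 : ℤ) + (i + 1 - i) = 0 by ring, show (0 : ℤ) + (i + 1 - i) = 1 by ring,
    reflectedSeries_zero]

lemma coeff_zero_besselI (i : ℤ) :
    PowerSeries.coeff 0 (besselI i) = if i = 0 then 1 else 0 := by
  split_ifs with h
  · subst h
    simpa using coeff_besselI_add 0 0
  · exact coeff_besselI_eq_zero (by omega)

lemma coeff_coeff_zero_reflectedSeries {b x : ℤ} (hb : 0 < b) (hx : 0 ≤ x) (k : ℕ) :
    PowerSeries.coeff k (PowerSeries.coeff 0 (reflectedSeries b x)) =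
      if x + k = b then 1 else 0 := by
  rw [coeff_reflectedSeries, map_sub, coeff_zero_besselI, coeff_zero_besselI,
    if_neg (show x + k + b ≠ 0 by omega), sub_zero]
  exact if_congr sub_eq_zero rfl rfl

lemma coeff_zero_det_reflectedMatrix {ℓ : ℕ} (hl : 1 ≤ ℓ) {x : ℕ → ℤ} (hx : Chamber (ℓ + 1) x) :
    PowerSeries.coeff 0 (reflectedMatrix ℓ x).det = if x = 0 then 1 else 0 := by
  rw [PowerSeries.coeff_zero_eq_constantCoeff_apply, RingHom.map_det]
  have hentry : ∀ i j : Fin ℓ, ∀ k : ℕ, PowerSeries.coeff k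
      ((PowerSeries.constantCoeff.mapMatrix (reflectedMatrix ℓ x)) i j) =
        if x i + (ℓ - i) + k = (ℓ : ℤ) - j then 1 else 0 := fun i j k => by
    rw [RingHom.mapMatrix_apply, Matrix.map_apply, ← PowerSeries.coeff_zero_eq_constantCoeff_apply,
      reflectedMatrix, Matrix.of_apply, coeff_coeff_zero_reflectedSeries (by omega)]
    have := hx.nonneg i
    omega
  split_ifs with h0
  · subst h0
    rw [Matrix.det_of_isLowerTriangular]
    · refine Finset.prod_eq_one fun i _ => ?_
      ext k
      rw [hentry, PowerSeries.coeff_one]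
      exact if_congr (by simp) rfl rfl
    · intro i j hij
      ext k
      rw [hentry, if_neg, map_zero]
      have : (i : ℕ) < j := hij
      simp only [Pi.zero_apply]
      omega
  · refine Matrix.det_eq_zero_of_row_eq_zero ⟨0, hl⟩ fun j => ?_
    ext k
    rw [hentry, if_neg, map_zero]
    have : 0 < x 0 := by
      refine lt_of_le_of_ne (hx.nonneg 0) fun h => h0 ?_
      funext i
      exact le_antisymm ((hx.1 (Nat.zero_le i)).trans_eq h.symm) (hx.nonneg i)
    simp only
    omega

lemma walkGF_eq_zero {ℓ n : ℕ} {x : ℕ → ℤ} (h : ¬ Chamber (ℓ + 1) x) : walkGF ℓ n x = 0 := by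
  have hneg : ¬ Chamber ℓ x := fun hx => h (hx.mono (Nat.le_succ ℓ))
  cases n <;> simp [walkGF, chamberRestrict, h, hneg]

/-- The reflected determinant is the exponential generating function of the walks. -/
lemma coeff_det_reflectedMatrix {ℓ : ℕ} (hl : 1 ≤ ℓ) (n : ℕ) {x : ℕ → ℤ}
    (hx : Chamber (ℓ + 1) x) :
    (n.factorial : PowerSeries ℚ) * PowerSeries.coeff n (reflectedMatrix ℓ x).det =
      walkGF ℓ n x := by
  induction n generalizing x with
  | zero =>
    rw [coeff_zero_det_reflectedMatrix hl hx, walkGF, chamberRestrict, if_pos hx]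
    simp
  | succ n ih =>
    have hd := congrArg (PowerSeries.coeff n) (formalDeriv_det_reflectedMatrix ℓ x)
    rw [coeff_formalDeriv, map_add, sumIncr, sumDecr, map_sum, map_sum] at hd
    have hadd : ∀ i ∈ Finset.range ℓ, (n.factorial : PowerSeries ℚ) *
        PowerSeries.coeff n (reflectedMatrix ℓ (x + Pi.single i 1)).det =
          walkGF ℓ n (x + Pi.single i 1) := by
      intro i hi
      rw [Finset.mem_range] at hi
      by_cases hc : Chamber (ℓ + 1) (x + Pi.single i 1)
      · exact ih hc
      · rw [walkGF_eq_zero hc]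
        rw [chamber_add_single_iff hx] at hc
        push Not at hc
        obtain ⟨h0, hlt⟩ := hc (by omega)
        have hge : x i ≤ x (i - 1) := hx.1 (Nat.sub_le _ _)
        rw [det_reflectedMatrix_eq_zero (i := i - 1) (by omega), map_zero, mul_zero]
        rw [add_single_apply, add_single_apply, if_pos (by omega), if_neg (by omega),
          show i - 1 + 1 = i by omega]
        omega
    have hsub : ∀ i ∈ Finset.range ℓ, (n.factorial : PowerSeries ℚ) *
        PowerSeries.coeff n (reflectedMatrix ℓ (x - Pi.single i 1)).det =
          walkGF ℓ n (x - Pi.single i 1) +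
            if i = ℓ - 1 then PowerSeries.X * chamberRestrict ℓ (walkGF ℓ n) x else 0 := by
      intro i hi
      rw [Finset.mem_range] at hi
      by_cases hc : Chamber (ℓ + 1) (x - Pi.single i 1)
      · rw [ih hc]
        split_ifs with h
        · rw [chamberRestrict, if_neg, mul_zero, add_zero]
          intro hx'
          have h1 := hx'.2.2 i (by omega)
          have h2 := (chamber_sub_single_iff hx).1 hc
          have h3 := hx.nonneg (i + 1)
          omega
        · rw [add_zero]
      · rw [walkGF_eq_zero hc, zero_add]
        rw [chamber_sub_single_iff hx, not_lt] at hc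
        have heq : x i = x (i + 1) := le_antisymm hc (hx.1 (Nat.le_succ i))
        split_ifs with h
        · have h0 : x i = 0 := heq.trans (hx.2.2 (i + 1) (by omega))
          have hx' : Chamber ℓ x := ⟨hx.1, hl, fun k hk => by
            by_cases hki : k = i
            · rw [hki, h0]
            · exact hx.2.2 k (by omega)⟩
          rw [det_reflectedMatrix_sub_single (by omega) h0, PowerSeries.coeff_C_mul,
            chamberRestrict, if_pos hx', ← ih hx]
          ring
        · rw [det_reflectedMatrix_eq_zero (i := i) (by omega), map_zero, mul_zero]
          rw [sub_single_apply, sub_single_apply, if_pos rfl, if_neg (by omega), heq]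
          ring
    have hfac : ((n + 1).factorial : PowerSeries ℚ) = (n + 1) * n.factorial := by
      rw [Nat.factorial_succ]; push_cast; ring
    rw [hfac, mul_comm _ (n.factorial : PowerSeries ℚ), mul_assoc,
      mul_comm _ (PowerSeries.coeff (n + 1) _), hd, mul_add, Finset.mul_sum, Finset.mul_sum,
      Finset.sum_congr rfl hadd, Finset.sum_congr rfl hsub, Finset.sum_add_distrib,
      Finset.sum_ite_eq' _ _ fun _ => _, if_pos (by simp; omega)]
    simp only [walkGF, Pi.add_apply, Pi.smul_apply, smul_eq_mul]
    rw [show chamberRestrict (ℓ + 1) (sumDecr ℓ (walkGF ℓ n) + sumIncr ℓ (walkGF ℓ n)) x =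
      (sumDecr ℓ (walkGF ℓ n) + sumIncr ℓ (walkGF ℓ n)) x from if_pos hx, Pi.add_apply, sumIncr,
      sumDecr]
    ring

/-- The coefficient of `q^p` in a power series in `t` over `ℚ⟦q⟧`. -/
def coeffSlice (p : ℕ) (f : PowerSeries (PowerSeries ℚ)) : PowerSeries ℚ :=
  PowerSeries.mk fun n => PowerSeries.coeff p (PowerSeries.coeff n f)

lemma coeffSlice_sum {ι : Type*} (p : ℕ) (s : Finset ι) (f : ι → PowerSeries (PowerSeries ℚ)) :
    coeffSlice p (∑ i ∈ s, f i) = ∑ i ∈ s, coeffSlice p (f i) := by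
  ext n
  simp [coeffSlice, map_sum]

lemma coeffSlice_mul_map_C (p : ℕ) (f : PowerSeries (PowerSeries ℚ)) (g : PowerSeries ℚ) :
    coeffSlice p (f * PowerSeries.map PowerSeries.C g) = coeffSlice p f * g := by
  ext n
  rw [coeffSlice, PowerSeries.coeff_mk, PowerSeries.coeff_mul, map_sum, PowerSeries.coeff_mul]
  refine Finset.sum_congr rfl fun x _ => ?_
  rw [PowerSeries.coeff_map, PowerSeries.coeff_mul_C, coeffSlice, PowerSeries.coeff_mk]

lemma coeffSlice_reflectedSeries (p : ℕ) (b x : ℤ) :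
    coeffSlice p (reflectedSeries b x) = besselI (x + p - b) - besselI (x + p + b) := by
  ext n
  rw [coeffSlice, PowerSeries.coeff_mk, coeff_reflectedSeries]

lemma det_reflectedMatrix_zero (m : ℕ) :
    (reflectedMatrix (m + 1) 0).det =
      (Matrix.of fun i j : Fin (m + 1) => if i = 0 then
        reflectedSeries (((m + 1 : ℕ) : ℤ) - j) ((m + 1 : ℕ) : ℤ) else
        PowerSeries.map PowerSeries.C
          (besselI (((m + 1 : ℕ) : ℤ) - i - (((m + 1 : ℕ) : ℤ) - j)) -
            besselI (((m + 1 : ℕ) : ℤ) - i + (((m + 1 : ℕ) : ℤ) - j)))).det := by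
  refine Matrix.det_eq_of_forall_row_eq_smul_add_pred
    (fun _ => PowerSeries.C PowerSeries.X) (fun j => ?_) fun i j => ?_
  · simp [reflectedMatrix]
  · rw [Matrix.of_apply, if_neg (Fin.succ_ne_zero i), reflectedMatrix, Matrix.of_apply,
      Matrix.of_apply, Pi.zero_apply, Pi.zero_apply, zero_add, zero_add, reflectedSeries_eq_add,
      show ((m + 1 : ℕ) : ℤ) - ((i.succ : Fin (m + 1)) : ℕ) + 1 =
        ((m + 1 : ℕ) : ℤ) - ((i.castSucc : Fin (m + 1)) : ℕ) by
          rw [Fin.val_succ, Fin.val_castSucc]; push_cast; ring]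

lemma coeffSlice_det_of_row_zero {m : ℕ} (p : ℕ) (r : Fin (m + 1) → PowerSeries (PowerSeries ℚ))
    (B : Matrix (Fin (m + 1)) (Fin (m + 1)) (PowerSeries ℚ)) :
    coeffSlice p (Matrix.of fun i j => if i = 0 then r j else
        PowerSeries.map PowerSeries.C (B i j)).det =
      (Matrix.of fun i j => if i = 0 then coeffSlice p (r j) else B i j).det := by
  rw [Matrix.det_succ_row_zero, Matrix.det_succ_row_zero, coeffSlice_sum]
  refine Finset.sum_congr rfl fun j _ => ?_
  have h1 : (Matrix.of fun i j => if i = 0 then r j else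
      PowerSeries.map PowerSeries.C (B i j)).submatrix Fin.succ j.succAbove =
        (PowerSeries.map PowerSeries.C).mapMatrix (B.submatrix Fin.succ j.succAbove) := by
    ext1 i k
    simp
  have h2 : (Matrix.of fun i j => if i = 0 then coeffSlice p (r j) else B i j).submatrix
      Fin.succ j.succAbove = B.submatrix Fin.succ j.succAbove := by
    ext1 i k
    simp
  rw [h1, h2, ← RingHom.map_det, Matrix.of_apply, Matrix.of_apply, if_pos rfl, if_pos rfl,
    show (-1 : PowerSeries (PowerSeries ℚ)) ^ (j : ℕ) =
      PowerSeries.map PowerSeries.C ((-1) ^ (j : ℕ)) by simp, mul_comm _ (r j), mul_assoc,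
    ← map_mul, coeffSlice_mul_map_C]
  ring

lemma det_besselI_eq (m p : ℕ) :
    (Matrix.of fun i j : Fin (m + 1) =>
      if (i : ℕ) = 0 then
        besselI ((p : ℤ) + ((m + 1 : ℕ) : ℤ) - ((j : ℤ) + 1)) -
          besselI ((p : ℤ) + ((m + 1 : ℕ) : ℤ) + ((j : ℤ) + 1))
      else besselI ((i : ℤ) + (j : ℤ) + 1) - besselI ((i : ℤ) - (j : ℤ) - 1)).det =
    (Matrix.of fun i j : Fin (m + 1) => if i = 0 then
      besselI (((m + 1 : ℕ) : ℤ) + p - (((m + 1 : ℕ) : ℤ) - j)) -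
        besselI (((m + 1 : ℕ) : ℤ) + p + (((m + 1 : ℕ) : ℤ) - j)) else
      besselI (((m + 1 : ℕ) : ℤ) - i - (((m + 1 : ℕ) : ℤ) - j)) -
        besselI (((m + 1 : ℕ) : ℤ) - i + (((m + 1 : ℕ) : ℤ) - j))).det := by
  set A := Matrix.of fun i j : Fin (m + 1) =>
      if (i : ℕ) = 0 then
        besselI ((p : ℤ) + ((m + 1 : ℕ) : ℤ) - ((j : ℤ) + 1)) -
          besselI ((p : ℤ) + ((m + 1 : ℕ) : ℤ) + ((j : ℤ) + 1))
      else besselI ((i : ℤ) + (j : ℤ) + 1) - besselI ((i : ℤ) - (j : ℤ) - 1) with hA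
  set B := Matrix.of fun i j : Fin (m + 1) => if i = 0 then
      besselI (((m + 1 : ℕ) : ℤ) + p - (((m + 1 : ℕ) : ℤ) - j)) -
        besselI (((m + 1 : ℕ) : ℤ) + p + (((m + 1 : ℕ) : ℤ) - j)) else
      besselI (((m + 1 : ℕ) : ℤ) - i - (((m + 1 : ℕ) : ℤ) - j)) -
        besselI (((m + 1 : ℕ) : ℤ) - i + (((m + 1 : ℕ) : ℤ) - j)) with hB
  have hrev : ∀ j : Fin (m + 1), ((m + 1 : ℕ) : ℤ) - ((Fin.rev j : Fin (m + 1)) : ℕ) = j + 1 :=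
    fun j => by rw [Fin.val_rev]; omega
  have hrot : A.submatrix (finRotate (m + 1)) id = Matrix.of fun i j =>
      (if i = Fin.last m then 1 else -1) * B.submatrix Fin.revPerm Fin.revPerm i j := by
    ext1 i j
    rw [Matrix.submatrix_apply, Matrix.of_apply, Matrix.submatrix_apply, hA, hB, Matrix.of_apply,
      Matrix.of_apply, Fin.revPerm_apply, Fin.revPerm_apply, hrev, hrev, id]
    induction i using Fin.lastCases with
    | last =>
      rw [finRotate_last, Fin.rev_last, if_pos rfl, if_pos rfl, if_pos (by simp), one_mul,
        add_comm (p : ℤ)]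
    | cast i =>
      rw [finRotate_apply, Fin.coeSucc_eq_succ, if_neg (by simp),
        if_neg (Fin.castSucc_lt_last i).ne, if_neg (by simp [Fin.rev_castSucc]), Fin.val_succ,
        Fin.val_castSucc, neg_one_mul, neg_sub]
      congr 2
      push_cast
      ring
  have hdet := congrArg Matrix.det hrot
  rw [Matrix.det_permute, sign_finRotate, Matrix.det_mul_column, Matrix.det_submatrix_equiv_self,
    Fin.prod_univ_castSucc] at hdet
  simp only [(Fin.castSucc_lt_last _).ne, if_false, if_true, Finset.prod_const, Finset.card_univ,
    Fintype.card_fin, mul_one, Nat.add_sub_cancel] at hdet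
  push_cast at hdet
  exact mul_left_cancel₀ (pow_ne_zero m (neg_ne_zero.2 one_ne_zero)) hdet

/-- For `m = 2ℓ`: `∑_{n≥0} i_{n,p}^{(m)} t^n/n! = det A`, where the first row of `A`
is `A_{1,j} = I_{p+ℓ−j} − I_{p+ℓ+j}` and the other rows are
`A_{i,j} = I_{i+j−1} − I_{i−j−1}` (`2 ≤ i ≤ ℓ`).  With 0-based indices `i,j : Fin ℓ`,
the first row (`i = 0`) is `I_{p+ℓ−j−1} − I_{p+ℓ+j+1}`, and the other entries
are `I_{i+j+1} − I_{i−j−1}`. -/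
theorem invCountFix_egf_even (ℓ : ℕ) (hl : 1 ≤ ℓ) (p : ℕ) :
    (PowerSeries.mk fun n : ℕ =>
        (invCountFix (2 * ℓ) p n : ℚ) / (Nat.factorial n : ℚ))
      = Matrix.det (Matrix.of fun i j : Fin ℓ =>
          if (i : ℕ) = 0 then
            besselI ((p : ℤ) + (ℓ : ℤ) - ((j : ℤ) + 1)) -
              besselI ((p : ℤ) + (ℓ : ℤ) + ((j : ℤ) + 1))
          else
            besselI ((i : ℤ) + (j : ℤ) + 1) - besselI ((i : ℤ) - (j : ℤ) - 1)) := by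
  obtain ⟨m, rfl⟩ := Nat.exists_eq_add_of_le' hl
  rw [det_besselI_eq]
  have h := coeffSlice_det_of_row_zero p
    (fun j : Fin (m + 1) => reflectedSeries (((m + 1 : ℕ) : ℤ) - j) ((m + 1 : ℕ) : ℤ))
    (Matrix.of fun i j : Fin (m + 1) =>
      besselI (((m + 1 : ℕ) : ℤ) - i - (((m + 1 : ℕ) : ℤ) - j)) -
        besselI (((m + 1 : ℕ) : ℤ) - i + (((m + 1 : ℕ) : ℤ) - j)))
  simp only [Matrix.of_apply, coeffSlice_reflectedSeries] at h
  rw [← h, ← det_reflectedMatrix_zero]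
  ext n
  have hn : (n.factorial : ℚ) ≠ 0 := Nat.cast_ne_zero.2 (Nat.factorial_ne_zero n)
  rw [PowerSeries.coeff_mk, coeffSlice, PowerSeries.coeff_mk, ← coeff_walkGF hl,
    ← coeff_det_reflectedMatrix hl n (chamber_zero.2 (Nat.succ_pos _)),
    ← map_natCast (PowerSeries.C (R := ℚ)), PowerSeries.coeff_C_mul, mul_div_cancel_left₀ _ hn]
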